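/- arXiv:2502.10981 — 9 statements merged into one kernel-verified Lean document; each statement's English description precedes it below -/
import Mathlib

section
/- For every integer d ≥ 2, the minimum forcing number of the d-dimensional hypercube Q_d equals 2^{d-2}, i.e. f(Q_d) = 2^{d-2}. -/
open SimpleGraph

noncomputable def forcingNumber {V : Type*} (G : SimpleGraph V) (M : G.Subgraph) : ℕ :=
  sInf {c | ∃ S : Set (Sym2 V), S ⊆ M.edgeSet ∧ S.ncard = c ∧
    ∀ M' : G.Subgraph, M'.IsPerfectMatching → S ⊆ M'.edgeSet → M' = M}

noncomputable def minForcingNumber {V : Type*} (G : SimpleGraph V) : ℕ :=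
  sInf {c | ∃ M : G.Subgraph, M.IsPerfectMatching ∧ forcingNumber G M = c}

def hypercube (d : ℕ) : SimpleGraph (Fin d → Bool) :=
  SimpleGraph.fromRel (fun u v => (Finset.univ.filter (fun i => u i ≠ v i)).card = 1)

section Hypercube

theorem hypercube_adj_iff_card {d : ℕ} (u v : Fin d → Bool) :
    (hypercube d).Adj u v ↔ (Finset.univ.filter (fun i => u i ≠ v i)).card = 1 := by
  rw [hypercube, SimpleGraph.fromRel_adj]
  constructor
  · rintro ⟨_, h | h⟩
    · exact h
    · simpa only [ne_comm] using h
  · intro h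
    refine ⟨?_, Or.inl h⟩
    rintro rfl
    simp at h

theorem hypercube_adj_succ {d : ℕ} (u v : Fin (d + 1) → Bool) :
    (hypercube (d + 1)).Adj u v ↔
      (u 0 ≠ v 0 ∧ Fin.tail u = Fin.tail v) ∨
        (u 0 = v 0 ∧ (hypercube d).Adj (Fin.tail u) (Fin.tail v)) := by
  have key : (Finset.univ.filter (fun i : Fin d => u i.succ ≠ v i.succ)).card = 0 ↔
      Fin.tail u = Fin.tail v := by
    simp [Finset.filter_eq_empty_iff, funext_iff, Fin.tail]
  rw [hypercube_adj_iff_card, hypercube_adj_iff_card, Fin.card_filter_univ_succ, ← key]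
  by_cases h : u 0 = v 0
  · rw [if_neg (not_not.2 h)]
    exact ⟨fun hn => Or.inr ⟨h, hn⟩, fun hn => (hn.resolve_left fun hn' => hn'.1 h).2⟩
  · rw [if_pos h, Nat.add_eq_right]
    exact ⟨fun hn => Or.inl ⟨h, hn⟩, fun hn => (hn.resolve_right fun hn' => h hn'.1).2⟩

/-- The parity of the number of coordinates of `v` equal to `true`. -/
def parity {d : ℕ} (v : Fin d → Bool) : ZMod 2 := ∑ i, ((v i).toNat : ZMod 2)

theorem parity_succ {d : ℕ} (v : Fin (d + 1) → Bool) :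
    parity v = (v 0).toNat + parity (Fin.tail v) := by
  simp [parity, Fin.sum_univ_succ, Fin.tail]

theorem hypercube_parity {d : ℕ} {u v : Fin d → Bool} (h : (hypercube d).Adj u v) :
    parity v = parity u + 1 := by
  induction d with
  | zero => exact absurd (Subsingleton.elim u v) h.ne
  | succ d ih =>
    rw [parity_succ u, parity_succ v]
    rcases (hypercube_adj_succ u v).1 h with ⟨h0, ht⟩ | ⟨h0, ht⟩
    · rw [ht]
      generalize parity (Fin.tail v) = t
      revert h0
      generalize u 0 = a
      generalize v 0 = b
      revert a b t
      decide
    · rw [h0, ih ht, add_assoc]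

end Hypercube

section WeightedAdjacency

/-- The two halves of a cube with respect to the first coordinate. -/
def cubeHalves (d : ℕ) : (Fin (d + 1) → Bool) ≃ (Fin d → Bool) ⊕ (Fin d → Bool) :=
  (Fin.consEquiv (fun _ => Bool)).symm.trans (Equiv.boolProdEquivSum _)

theorem exists_weighting_succ {d : ℕ} {a b c : ℚ} (ha : a ≠ 0) (hb : b ≠ 0)
    {A : Matrix (Fin d → Bool) (Fin d → Bool) ℚ}
    (hA : ∀ u v, A u v ≠ 0 ↔ (hypercube d).Adj u v) (hsq : A * A = c • 1) :
    ∃ B : Matrix (Fin (d + 1) → Bool) (Fin (d + 1) → Bool) ℚ,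
      (∀ u v, B u v ≠ 0 ↔ (hypercube (d + 1)).Adj u v) ∧ B * B = (c + a * b) • 1 := by
  refine ⟨(Matrix.fromBlocks A (a • 1) (b • 1) (-A)).submatrix (cubeHalves d) (cubeHalves d),
    ?_, ?_⟩
  · intro u v
    rw [hypercube_adj_succ]
    simp only [← hA]
    obtain ⟨⟨s, x⟩, rfl⟩ := (Fin.consEquiv (fun _ => Bool)).surjective u
    obtain ⟨⟨t, y⟩, rfl⟩ := (Fin.consEquiv (fun _ => Bool)).surjective v
    have tail_cons : ∀ (r : Bool) (z : Fin d → Bool),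
        Fin.tail (Fin.consEquiv (fun _ => Bool) (r, z)) = z := fun _ _ => rfl
    rw [tail_cons, tail_cons]
    cases s <;> cases t <;>
      simp [cubeHalves, Equiv.boolProdEquivSum, Matrix.one_apply, ha, hb]
  · rw [Matrix.submatrix_mul_equiv, Matrix.fromBlocks_multiply]
    have : Matrix.fromBlocks (A * A + (a • 1 : Matrix _ _ ℚ) * (b • 1 : Matrix _ _ ℚ))
        (A * (a • 1 : Matrix _ _ ℚ) + (a • 1 : Matrix _ _ ℚ) * -A)
        ((b • 1 : Matrix _ _ ℚ) * A + -A * (b • 1 : Matrix _ _ ℚ))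
        ((b • 1 : Matrix _ _ ℚ) * (a • 1 : Matrix _ _ ℚ) + -A * -A) = (c + a * b) • 1 := by
      rw [← Matrix.fromBlocks_one, Matrix.fromBlocks_smul]
      congr 1
      · simp [hsq, add_smul, smul_smul, mul_comm]
      · simp
      · simp
      · simp [hsq, add_smul, smul_smul, add_comm]
    rw [this, Matrix.submatrix_smul]
    simp

theorem exists_weighting_sq_eq (d : ℕ) :
    ∃ A : Matrix (Fin d → Bool) (Fin d → Bool) ℚ,
      (∀ u v, A u v ≠ 0 ↔ (hypercube d).Adj u v) ∧ A * A = (d : ℚ) • 1 := by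
  induction d with
  | zero =>
    refine ⟨0, fun u v => ?_, by simp⟩
    simp [Subsingleton.elim u v]
  | succ d ih =>
    obtain ⟨A, hA, hsq⟩ := ih
    obtain ⟨B, hB, h⟩ := exists_weighting_succ one_ne_zero one_ne_zero hA hsq
    exact ⟨B, hB, by simpa using h⟩

theorem exists_weighting_sq_eq_zero (d : ℕ) :
    ∃ A : Matrix (Fin (d + 2) → Bool) (Fin (d + 2) → Bool) ℚ,
      (∀ u v, A u v ≠ 0 ↔ (hypercube (d + 2)).Adj u v) ∧ A * A = 0 := by
  obtain ⟨A, hA, hsq⟩ := exists_weighting_sq_eq (d + 1)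
  obtain ⟨B, hB, h⟩ := exists_weighting_succ one_ne_zero
    (neg_ne_zero.2 (Nat.cast_ne_zero.2 d.succ_ne_zero)) hA hsq
  exact ⟨B, hB, by simpa using h⟩

end WeightedAdjacency

theorem SimpleGraph.Subgraph.IsPerfectMatching.eq_of_edgeSet_subset {V : Type*}
    {G : SimpleGraph V} {M M' : G.Subgraph} (hM : M.IsPerfectMatching)
    (hM' : M'.IsPerfectMatching) (h : M.edgeSet ⊆ M'.edgeSet) : M' = M := by
  rw [Subgraph.isPerfectMatching_iff] at hM hM'
  have hadj : ∀ v w, M.Adj v w → M'.Adj v w := fun v w hvw => h (Subgraph.mem_edgeSet.2 hvw)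
  ext v w
  · obtain ⟨x, hx, _⟩ := hM v
    exact iff_of_true (hadj v x hx).fst_mem hx.fst_mem
  · refine ⟨fun hvw => ?_, hadj v w⟩
    obtain ⟨x, hx, _⟩ := hM v
    rwa [(hM' v).unique hvw (hadj v x hx)]

section LowerBound

variable {V : Type*} {G : SimpleGraph V}

/-- The edges from a colour class `b` of a bipartite graph to their images under a permutation. -/
def permSubgraph (σ : Equiv.Perm V) (hσ : ∀ v, G.Adj v (σ v)) (c : V → ZMod 2) (b : ZMod 2) :
    G.Subgraph where
  verts := Set.univ
  Adj u v := (c u = b ∧ σ u = v) ∨ (c v = b ∧ σ v = u)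
  adj_sub := by
    rintro u v (⟨_, rfl⟩ | ⟨_, rfl⟩)
    · exact hσ u
    · exact (hσ v).symm
  edge_vert _ := Set.mem_univ _
  symm := ⟨fun _ _ h => h.symm⟩

theorem zmod_two_eq_add_one {x y : ZMod 2} (h : x ≠ y) : y = x + 1 := by
  revert x y
  decide

theorem permSubgraph_isPerfectMatching {σ : Equiv.Perm V} (hσ : ∀ v, G.Adj v (σ v))
    {c : V → ZMod 2} (hc : ∀ u v, G.Adj u v → c v = c u + 1) (b : ZMod 2) :
    (permSubgraph σ hσ c b).IsPerfectMatching := by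
  rw [Subgraph.isPerfectMatching_iff]
  intro v
  by_cases hv : c v = b
  · refine ⟨σ v, Or.inl ⟨hv, rfl⟩, ?_⟩
    rintro w (⟨_, rfl⟩ | ⟨hw, rfl⟩)
    · rfl
    · have := hc _ _ (hσ w)
      rw [hv, hw] at this
      simp at this
  · have h := hc _ _ (hσ (σ.symm v))
    rw [Equiv.apply_symm_apply] at h
    have hb := zmod_two_eq_add_one hv
    refine ⟨σ.symm v, Or.inr ⟨?_, by simp⟩, ?_⟩
    · rw [hb, h, add_assoc, CharTwo.add_self_eq_zero, add_zero]
    · rintro w (⟨hv', _⟩ | ⟨_, rfl⟩)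
      · exact absurd hv' hv
      · simp

/-- In a bipartite graph with a nowhere vanishing edge weighting of square zero, at least a quarter
as many edges as there are vertices are needed to force a perfect matching. -/
theorem card_le_four_mul_ncard_of_forcing [Fintype V] [DecidableEq V]
    {c : V → ZMod 2} (hc : ∀ u v, G.Adj u v → c v = c u + 1)
    {A : Matrix V V ℚ} (hA : ∀ u v, A u v ≠ 0 ↔ G.Adj u v) (hsq : A * A = 0)
    {M : G.Subgraph} (hM : M.IsPerfectMatching) {S : Set (Sym2 V)} (hS : S ⊆ M.edgeSet)
    (hforce : ∀ M' : G.Subgraph, M'.IsPerfectMatching → S ⊆ M'.edgeSet → M' = M) :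
    Fintype.card V ≤ 4 * S.ncard := by
  classical
  rw [Subgraph.isPerfectMatching_iff] at hM
  choose p hp hpu using hM
  have hpp : Function.Involutive p := fun v => (hpu (p v) v (hp v).symm).symm
  let W : Finset V := S.toFinset.biUnion Sym2.toFinset
  have hW : ∀ v, v ∈ W ↔ ∃ e ∈ S, v ∈ e := by simp [W]
  have hWp : ∀ v, v ∈ W → p v ∈ W := by
    intro v hv
    obtain ⟨e, he, hve⟩ := (hW v).1 hv
    obtain ⟨w, rfl⟩ := hve
    refine (hW _).2 ⟨_, he, ?_⟩
    rw [← hpu v w (hS he)]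
    exact Sym2.mem_mk_right _ _
  have hWcard : W.card ≤ S.ncard * 2 := by
    rw [Set.ncard_eq_toFinset_card']
    refine Finset.card_biUnion_le_card_mul _ _ _ fun e _ => ?_
    induction e with
    | _ x y => simpa [Sym2.toFinset_mk_eq] using Finset.card_le_two
  have hunique : ∀ σ : Equiv.Perm V, (∀ v, G.Adj v (σ v)) → (∀ v ∈ W, σ v = p v) →
      ∀ v, σ v = p v := by
    intro σ hσ hσW v
    have hsub : S ⊆ (permSubgraph σ hσ c (c v)).edgeSet := by
      intro e he
      induction e with
      | _ x y =>
        have hxy : M.Adj x y := hS he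
        have hx := hσW x ((hW x).2 ⟨_, he, Sym2.mem_mk_left _ _⟩)
        have hy := hσW y ((hW y).2 ⟨_, he, Sym2.mem_mk_right _ _⟩)
        rw [← hpu x y hxy] at hx
        rw [← hpu y x hxy.symm] at hy
        by_cases h : c x = c v
        · exact Or.inl ⟨h, hx⟩
        · refine Or.inr ⟨?_, hy⟩
          rw [zmod_two_eq_add_one h, hc x y hxy.adj_sub]
    have heq := hforce _ (permSubgraph_isPerfectMatching hσ hc (c v)) hsub
    have hadj : (permSubgraph σ hσ c (c v)).Adj v (σ v) := Or.inl ⟨rfl, rfl⟩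
    rw [heq] at hadj
    exact hpu _ _ hadj
  let B : Matrix V V ℚ := fun v w => if v ∈ W then (if w = p v then 1 else 0) else A v w
  have hB : ∀ v w, B v w ≠ 0 → G.Adj v w ∧ (v ∈ W → w = p v) := by
    intro v w h
    by_cases hv : v ∈ W
    · by_cases hw : w = p v
      · exact ⟨hw ▸ (hp v).adj_sub, fun _ => hw⟩
      · simp [B, hv, hw] at h
    · exact ⟨(hA v w).1 (by simpa [B, hv] using h), fun h => absurd h hv⟩
  have hBp : ∀ v, B v (p v) ≠ 0 := by
    intro v
    by_cases hv : v ∈ W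
    · simp [B, hv]
    · simpa [B, hv] using (hA v (p v)).2 (hp v).adj_sub
  have hdet : B.det ≠ 0 := by
    rw [← Matrix.det_transpose, Matrix.det_apply,
      Finset.sum_eq_single (hpp.toPerm p)]
    · rw [Ne, smul_eq_zero_iff_eq, Finset.prod_eq_zero_iff]
      simpa using hBp
    · intro σ _ hσ
      by_contra h
      have h' : ∏ i, B.transpose (σ i) i ≠ 0 := fun h0 => h (by rw [h0, smul_zero])
      rw [Finset.prod_ne_zero_iff] at h'
      have h'' := fun v => hB v (σ v) (h' v (Finset.mem_univ v))
      exact hσ (Equiv.ext (hunique σ (fun v => (h'' v).1) fun v => (h'' v).2))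
    · simp
  have hker : Module.finrank ℚ (LinearMap.ker A.mulVecLin) ≤ W.card := by
    have hinj : Function.Injective
        ((LinearMap.funLeft ℚ ℚ ((↑) : W → V)).comp (LinearMap.ker A.mulVecLin).subtype) := by
      rw [← LinearMap.ker_eq_bot, LinearMap.ker_eq_bot']
      rintro ⟨x, hx⟩ h
      have hxW : ∀ v ∈ W, x v = 0 := fun v hv => congrFun h ⟨v, hv⟩
      have hx' : A.mulVec x = 0 := hx
      have : B.mulVec x = 0 := by
        ext v
        by_cases hv : v ∈ W
        · simpa [B, Matrix.mulVec, dotProduct, hv] using hxW _ (hWp v hv)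
        · simpa [B, Matrix.mulVec, dotProduct, hv] using congrFun hx' v
      exact Subtype.ext (Matrix.eq_zero_of_mulVec_eq_zero hdet this)
    simpa using LinearMap.finrank_le_finrank_of_injective hinj
  have hrange : LinearMap.range A.mulVecLin ≤ LinearMap.ker A.mulVecLin := by
    rintro _ ⟨x, rfl⟩
    simp [hsq]
  have h1 := Submodule.finrank_mono hrange
  have h2 := LinearMap.finrank_range_add_finrank_ker A.mulVecLin
  rw [Module.finrank_fintype_fun_eq_card] at h2
  omega

end LowerBound

section UpperBound

/-- Flip the first coordinate. -/
def flipZero {d : ℕ} (v : Fin (d + 1) → Bool) : Fin (d + 1) → Bool :=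
  Fin.cons (!v 0) (Fin.tail v)

theorem flipZero_flipZero {d : ℕ} (v : Fin (d + 1) → Bool) : flipZero (flipZero v) = v := by
  simp [flipZero]

theorem hypercube_adj_flipZero {d : ℕ} (v : Fin (d + 1) → Bool) :
    (hypercube (d + 1)).Adj v (flipZero v) := by
  simp [hypercube_adj_succ, flipZero]

/-- All edges of the cube in the direction of the first coordinate. -/
def flipZeroMatching (d : ℕ) : (hypercube (d + 1)).Subgraph where
  verts := Set.univ
  Adj u v := flipZero u = v
  adj_sub := by
    rintro u v rfl
    exact hypercube_adj_flipZero u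
  edge_vert _ := Set.mem_univ _
  symm := ⟨by
    rintro u v rfl
    exact flipZero_flipZero u⟩

theorem flipZeroMatching_isPerfectMatching (d : ℕ) :
    (flipZeroMatching d).IsPerfectMatching := by
  rw [Subgraph.isPerfectMatching_iff]
  exact fun v => ⟨flipZero v, rfl, fun w h => Eq.symm h⟩

/-- The vertex with first coordinate `false`, even parity, and given last coordinates. -/
def evenVertex {d : ℕ} (x : Fin d → Bool) : Fin (d + 2) → Bool :=
  Fin.cons false (Fin.cons (decide (parity x = 1)) x)

theorem eq_evenVertex_or {d : ℕ} {v : Fin (d + 2) → Bool} (hv : parity (Fin.tail v) = 0) :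
    v = evenVertex (Fin.tail (Fin.tail v)) ∨ v = flipZero (evenVertex (Fin.tail (Fin.tail v))) := by
  have h : Fin.tail v 0 = decide (parity (Fin.tail (Fin.tail v)) = 1) := by
    rw [parity_succ] at hv
    revert hv
    generalize parity (Fin.tail (Fin.tail v)) = t
    generalize Fin.tail v 0 = a
    revert a t
    decide
  have ht : Fin.tail v = Fin.cons (decide (parity (Fin.tail (Fin.tail v)) = 1))
      (Fin.tail (Fin.tail v)) := by
    rw [← h, Fin.cons_self_tail]
  cases h0 : v 0
  · left
    rw [evenVertex, ← ht, ← h0, Fin.cons_self_tail]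
  · right
    rw [evenVertex, ← ht, flipZero, Fin.cons_zero, Fin.tail_cons, Bool.not_false, ← h0,
      Fin.cons_self_tail]

theorem exists_forcing_hypercube (d : ℕ) :
    ∃ S : Set (Sym2 (Fin (d + 2) → Bool)), S ⊆ (flipZeroMatching (d + 1)).edgeSet ∧
      S.ncard ≤ 2 ^ d ∧ ∀ M : (hypercube (d + 2)).Subgraph, M.IsPerfectMatching →
        S ⊆ M.edgeSet → M = flipZeroMatching (d + 1) := by
  refine ⟨Set.range fun x : Fin d → Bool => s(evenVertex x, flipZero (evenVertex x)), ?_, ?_, ?_⟩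
  · rintro _ ⟨x, rfl⟩
    exact (rfl : flipZero (evenVertex x) = flipZero (evenVertex x))
  · rw [← Set.image_univ]
    refine (Set.ncard_image_le Set.finite_univ).trans ?_
    simp [Set.ncard_univ]
  · intro M hM hS
    rw [Subgraph.isPerfectMatching_iff] at hM
    have heven : ∀ v, parity (Fin.tail v) = 0 → M.Adj v (flipZero v) := by
      intro v hv
      have hadj : M.Adj (evenVertex (Fin.tail (Fin.tail v)))
          (flipZero (evenVertex (Fin.tail (Fin.tail v)))) := hS ⟨_, rfl⟩
      rcases eq_evenVertex_or hv with h | h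
      · rwa [← h] at hadj
      · rw [← h] at hadj
        have h' := congrArg flipZero h
        rw [flipZero_flipZero] at h'
        rw [h']
        exact hadj.symm
    have hall : ∀ v w, M.Adj v w → flipZero v = w := by
      intro v w hvw
      rcases (hypercube_adj_succ v w).1 hvw.adj_sub with ⟨h0, ht⟩ | ⟨h0, ht⟩
      · rw [flipZero, ht, Bool.not_eq.2 h0, Fin.cons_self_tail]
      · by_cases hv : parity (Fin.tail v) = 0
        · exact (hM v).unique (heven v hv) hvw
        · have hw : parity (Fin.tail w) = 0 := by
            rw [hypercube_parity ht, ← zmod_two_eq_add_one hv]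
          rw [← (hM w).unique (heven w hw) hvw.symm, flipZero_flipZero]
    ext v w
    · obtain ⟨w, hw, _⟩ := hM v
      exact iff_of_true hw.fst_mem (Set.mem_univ _)
    · refine ⟨hall v w, ?_⟩
      rintro (rfl : flipZero v = w)
      obtain ⟨w, hw, _⟩ := hM v
      rw [hall v w hw]
      exact hw

end UpperBound

theorem stmt0 (d : ℕ) (hd : 2 ≤ d) :
    minForcingNumber (hypercube d) = 2 ^ (d - 2) := by
  obtain ⟨d, rfl⟩ := Nat.exists_eq_add_of_le' hd
  rw [Nat.add_sub_cancel]
  apply le_antisymm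
  · obtain ⟨S, hS, hcard, hforce⟩ := exists_forcing_hypercube d
    have h1 : minForcingNumber (hypercube (d + 2)) ≤
        forcingNumber (hypercube (d + 2)) (flipZeroMatching (d + 1)) :=
      Nat.sInf_le ⟨_, flipZeroMatching_isPerfectMatching (d + 1), rfl⟩
    have h2 : forcingNumber (hypercube (d + 2)) (flipZeroMatching (d + 1)) ≤ S.ncard :=
      Nat.sInf_le ⟨S, hS, rfl, hforce⟩
    exact h1.trans (h2.trans hcard)
  · refine le_csInf ⟨_, _, flipZeroMatching_isPerfectMatching (d + 1), rfl⟩ ?_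
    rintro _ ⟨M, hM, rfl⟩
    refine le_csInf ⟨_, M.edgeSet, subset_rfl, rfl, fun M' hM' h =>
      hM.eq_of_edgeSet_subset hM' h⟩ ?_
    · rintro _ ⟨S, hS, rfl, hforce⟩
      obtain ⟨A, hA, hsq⟩ := exists_weighting_sq_eq_zero d
      have := card_le_four_mul_ncard_of_forcing (fun _ _ => hypercube_parity) hA hsq hM hS hforce
      rw [Fintype.card_fun, Fintype.card_bool, Fintype.card_fin, pow_add] at this
      omega
end

section
/- Let G be a finite simple graph of order n with a perfect matching, and suppose that every induced subgraph of G having a unique perfect matching has at most k vertices (k being attained by some induced subgraph with a unique perfect matching). Then every perfect matching M of G has forcing number f(G,M) ≥ (n − k)/2. -/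
open SimpleGraph

theorem Set.ncard_setOf_exists_mem_sym2_le {V : Type*} [Finite V] (S : Set (Sym2 V)) :
    {v | ∃ e ∈ S, v ∈ e}.ncard ≤ 2 * S.ncard := by
  classical
  have := Fintype.ofFinite V
  have h : {v | ∃ e ∈ S, v ∈ e} = ↑(S.toFinset.biUnion Sym2.toFinset) := by
    ext v
    simp
  rw [h, Set.ncard_coe_finset, Set.ncard_eq_toFinset_card', mul_comm]
  refine Finset.card_biUnion_le_card_mul _ _ _ fun e _ => ?_
  rw [Sym2.card_toFinset]
  split_ifs <;> norm_num

theorem SimpleGraph.Subgraph.IsPerfectMatching.ext_of_adj_imp {V : Type*} {G : SimpleGraph V}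
    {M N : G.Subgraph} (hM : M.IsPerfectMatching) (hN : N.IsPerfectMatching)
    (h : ∀ u v, M.Adj u v → N.Adj u v) : N = M := by
  refine Subgraph.ext ?_ ?_
  · rw [hN.2.verts_eq_univ, hM.2.verts_eq_univ]
  · ext u v
    refine ⟨fun huv => ?_, h u v⟩
    obtain ⟨w, hw, -⟩ := Subgraph.isPerfectMatching_iff.1 hM u
    rwa [(Subgraph.isPerfectMatching_iff.1 hN u).unique huv (h u w hw)]

/-- Deleting the vertices covered by a forcing set leaves a graph with a unique perfect
matching. -/
theorem existsUnique_isPerfectMatching_induce_compl {V : Type*} (G : SimpleGraph V)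
    (M : G.Subgraph) (hM : M.IsPerfectMatching) (S : Set (Sym2 V)) (hS : S ⊆ M.edgeSet)
    (hforce : ∀ M' : G.Subgraph, M'.IsPerfectMatching → S ⊆ M'.edgeSet → M' = M) :
    ∃! N : (G.induce {v | ∃ e ∈ S, v ∈ e}ᶜ).Subgraph, N.IsPerfectMatching := by
  have hM' := Subgraph.isPerfectMatching_iff.1 hM
  have hleft : ∀ {u v : V}, s(u, v) ∈ S → u ∈ {v | ∃ e ∈ S, v ∈ e} := fun h =>
    ⟨_, h, Sym2.mem_mk_left _ _⟩
  have hright : ∀ {u v : V}, s(u, v) ∈ S → v ∈ {v | ∃ e ∈ S, v ∈ e} := fun h =>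
    ⟨_, h, Sym2.mem_mk_right _ _⟩
  generalize hT : {v | ∃ e ∈ S, v ∈ e} = T at hleft hright
  have hmem : ∀ u ∈ T, ∃ v, s(u, v) ∈ S := by
    rw [← hT]
    rintro u ⟨e, he, hu⟩
    obtain ⟨v, rfl⟩ := hu
    exact ⟨v, he⟩
  have hR : (M.comap (Embedding.induce Tᶜ).toHom).IsPerfectMatching := by
    rw [Subgraph.isPerfectMatching_iff]
    rintro ⟨u, hu⟩
    obtain ⟨v, huv, hv⟩ := hM' u
    have hvT : v ∉ T := fun hvT => by
      obtain ⟨w, hw⟩ := hmem v hvT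
      have : w = u := (hM' v).unique (hS hw) huv.symm
      exact hu (hright (this ▸ hw))
    refine ⟨⟨v, hvT⟩, ⟨M.adj_sub huv, huv⟩, ?_⟩
    rintro ⟨w, hw⟩ hw'
    exact Subtype.ext (hv w hw'.2)
  refine ⟨_, hR, fun N hN => ?_⟩
  let P : G.Subgraph :=
    { verts := Set.univ
      Adj := fun u v => (∃ hu hv, N.Adj ⟨u, hu⟩ ⟨v, hv⟩) ∨ s(u, v) ∈ S
      adj_sub := by
        rintro u v (⟨hu, hv, h⟩ | h)
        · exact N.adj_sub h
        · exact M.adj_sub (hS h)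
      edge_vert := fun _ => Set.mem_univ _
      symm := by
        constructor
        rintro u v (⟨hu, hv, h⟩ | h)
        · exact Or.inl ⟨hv, hu, h.symm⟩
        · exact Or.inr (Sym2.eq_swap ▸ h) }
  have hP : P.IsPerfectMatching := by
    rw [Subgraph.isPerfectMatching_iff]
    intro u
    by_cases hu : u ∈ T
    · obtain ⟨v, hv⟩ := hmem u hu
      refine ⟨v, Or.inr hv, ?_⟩
      rintro w (⟨hu', -, -⟩ | h)
      · exact absurd hu hu'
      · exact (hM' u).unique (hS h) (hS hv)
    · obtain ⟨v, hv, huniq⟩ := Subgraph.isPerfectMatching_iff.1 hN ⟨u, hu⟩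
      refine ⟨v, Or.inl ⟨hu, v.2, hv⟩, ?_⟩
      rintro w (⟨hu', hw, h⟩ | h)
      · exact congrArg Subtype.val (huniq ⟨w, hw⟩ h)
      · exact absurd (hleft h) hu
  have hPM : P = M := hforce P hP fun e => by
    induction e with
    | _ u v => exact fun h => Or.inr h
  refine (hN.ext_of_adj_imp hR fun u v huv => ⟨N.adj_sub huv, ?_⟩).symm
  rw [← hPM]
  exact Or.inl ⟨u.2, v.2, huv⟩

theorem exists_forcing_set_ncard_eq_forcingNumber {V : Type*} (G : SimpleGraph V)
    (M : G.Subgraph) (hM : M.IsPerfectMatching) :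
    ∃ S : Set (Sym2 V), S ⊆ M.edgeSet ∧ S.ncard = forcingNumber G M ∧
      ∀ M' : G.Subgraph, M'.IsPerfectMatching → S ⊆ M'.edgeSet → M' = M :=
  Nat.sInf_mem (s := {c | ∃ S : Set (Sym2 V), S ⊆ M.edgeSet ∧ S.ncard = c ∧
    ∀ M' : G.Subgraph, M'.IsPerfectMatching → S ⊆ M'.edgeSet → M' = M})
    ⟨_, M.edgeSet, subset_rfl, rfl, fun _ hM' h =>
      hM.ext_of_adj_imp hM' fun _ _ huv => h (Subgraph.mem_edgeSet.2 huv)⟩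

theorem stmt1 {V : Type*} [Fintype V] (G : SimpleGraph V) (k : ℕ)
    (hub : ∀ s : Set V, (∃! M : (G.induce s).Subgraph, M.IsPerfectMatching) → s.ncard ≤ k)
    (hattain : ∃ s : Set V, s.ncard = k ∧
      ∃! M : (G.induce s).Subgraph, M.IsPerfectMatching)
    (M : G.Subgraph) (hM : M.IsPerfectMatching) :
    ((Fintype.card V : ℝ) - k) / 2 ≤ (forcingNumber G M : ℝ) := by
  obtain ⟨S, hS, hcard, hforce⟩ := exists_forcing_set_ncard_eq_forcingNumber G M hM
  have hk := hub _ (existsUnique_isPerfectMatching_induce_compl G M hM S hS hforce)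
  have hT := Set.ncard_setOf_exists_mem_sym2_le S
  have hsum := Set.ncard_add_ncard_compl {v | ∃ e ∈ S, v ∈ e}
  rw [Nat.card_eq_fintype_card] at hsum
  have h : (Fintype.card V : ℝ) ≤ 2 * forcingNumber G M + k := by
    norm_cast
    omega
  linarith
end

section
/- Let G be a finite simple bipartite graph with a perfect matching and let A be a weighted adjacency matrix of G over a field F. Then f(G) ≥ (|V(G)| − rank(A))/2, i.e. the minimum forcing number of G is at least half the corank of A. -/
open SimpleGraph

namespace SimpleGraph

variable {V : Type*} {G : SimpleGraph V}

/-- A perfect matching contained in another one is equal to it. -/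
theorem Subgraph.IsPerfectMatching.eq_of_edgeSet_subset_s2 {M M' : G.Subgraph}
    (hM : M.IsPerfectMatching) (hM' : M'.IsPerfectMatching) (h : M.edgeSet ⊆ M'.edgeSet) :
    M' = M := by
  have hle : ∀ {u v}, M.Adj u v → M'.Adj u v := fun {u v} huv => h (a := s(u, v)) huv
  refine Subgraph.ext ?_ ?_
  · rw [hM.2.verts_eq_univ, hM'.2.verts_eq_univ]
  · funext u v
    refine propext ⟨fun huv => ?_, hle⟩
    obtain ⟨w, hw, -⟩ := Subgraph.isPerfectMatching_iff.1 hM u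
    rwa [(Subgraph.isPerfectMatching_iff.1 hM' u).unique huv (hle hw)]

/-- Given a permutation of the vertices along edges, the subgraph of the edges joining each vertex
of colour `b` to its image. -/
def Subgraph.ofPerm (G : SimpleGraph V) (c : V → Bool) (τ : Equiv.Perm V)
    (hτ : ∀ v, G.Adj v (τ v)) (b : Bool) : G.Subgraph where
  verts := Set.univ
  Adj u v := (c u = b ∧ v = τ u) ∨ (c v = b ∧ u = τ v)
  adj_sub := by
    rintro u v (⟨-, rfl⟩ | ⟨-, rfl⟩)
    exacts [hτ _, (hτ _).symm]
  edge_vert _ := Set.mem_univ _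
  symm := ⟨fun _ _ h => h.symm⟩

theorem Subgraph.isPerfectMatching_ofPerm {c : V → Bool} (hc : ∀ u v, G.Adj u v → c u ≠ c v)
    {τ : Equiv.Perm V} (hτ : ∀ v, G.Adj v (τ v)) (b : Bool) :
    (Subgraph.ofPerm G c τ hτ b).IsPerfectMatching := by
  refine Subgraph.isPerfectMatching_iff.2 fun v => ?_
  by_cases hv : c v = b
  · refine ⟨τ v, Or.inl ⟨hv, rfl⟩, ?_⟩
    rintro w (⟨-, rfl⟩ | ⟨hw, rfl⟩)
    · rfl
    · exact absurd (hw.trans hv.symm) (hc _ _ (hτ w))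
  · refine ⟨τ.symm v, Or.inr ⟨?_, by simp⟩, ?_⟩
    · have := hc _ _ (hτ (τ.symm v))
      rw [Equiv.apply_symm_apply] at this
      cases h : c (τ.symm v) <;> cases h' : c v <;> cases b <;> simp_all
    · rintro w (⟨h, -⟩ | ⟨-, rfl⟩)
      · exact absurd h hv
      · simp

/-- The involution exchanging the ends of each edge of a perfect matching. -/
theorem Subgraph.IsPerfectMatching.exists_involutive {M : G.Subgraph}
    (hM : M.IsPerfectMatching) :
    ∃ p : V → V, Function.Involutive p ∧ ∀ u v, M.Adj u v ↔ p u = v := by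
  choose p hp hp' using Subgraph.isPerfectMatching_iff.1 hM
  have key : ∀ u v, M.Adj u v ↔ p u = v := fun u v =>
    ⟨fun h => (hp' u v h).symm, fun h => h ▸ hp u⟩
  exact ⟨p, fun u => (key _ _).1 (hp u).symm, key⟩

/-- In a bipartite graph, a permutation moving every vertex along an edge and agreeing with a
perfect matching on a forcing set agrees with it everywhere. -/
theorem Subgraph.perm_eq_of_forcing {c : V → Bool} (hc : ∀ u v, G.Adj u v → c u ≠ c v)
    {M : G.Subgraph} {p : V → V} (hp : ∀ u v, M.Adj u v ↔ p u = v) {S : Set (Sym2 V)}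
    (hSM : S ⊆ M.edgeSet)
    (hS : ∀ M' : G.Subgraph, M'.IsPerfectMatching → S ⊆ M'.edgeSet → M' = M)
    {τ : Equiv.Perm V} (hτ : ∀ v, G.Adj v (τ v)) (hτS : ∀ v, s(v, p v) ∈ S → τ v = p v) (v : V) :
    τ v = p v := by
  have hM' := hS _ (isPerfectMatching_ofPerm hc hτ (c v)) ?_
  · refine ((hp _ _).1 ?_).symm
    rw [← hM']
    exact Or.inl ⟨rfl, rfl⟩
  · rintro ⟨x, y⟩ he
    have hxy : M.Adj x y := hSM he
    have hx : p x = y := (hp _ _).1 hxy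
    have hy : p y = x := (hp _ _).1 hxy.symm
    change (c x = c v ∧ y = τ x) ∨ (c y = c v ∧ x = τ y)
    have hτx : τ x = y := (hτS x (by rwa [hx])).trans hx
    have hτy : τ y = x := (hτS y (by rw [hy, Sym2.eq_swap]; exact he)).trans hy
    have hne := hc _ _ (M.adj_sub hxy)
    rw [hτx, hτy]
    cases h : c x <;> cases h' : c y <;> cases h'' : c v <;> simp_all

/-- The vertices not covered by a forcing set index a nonsingular principal submatrix. -/
theorem Subgraph.det_submatrix_ne_zero_of_forcing {F : Type*} [Fintype V] [DecidableEq V] [Field F]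
    {c : V → Bool} (hc : ∀ u v, G.Adj u v → c u ≠ c v)
    {A : Matrix V V F} (hA : ∀ u v, A u v ≠ 0 ↔ G.Adj u v)
    {M : G.Subgraph} {p : V → V} (hinv : Function.Involutive p)
    (hp : ∀ u v, M.Adj u v ↔ p u = v) {S : Set (Sym2 V)} (hSM : S ⊆ M.edgeSet)
    (hS : ∀ M' : G.Subgraph, M'.IsPerfectMatching → S ⊆ M'.edgeSet → M' = M)
    {W : V → Prop} [DecidablePred W] (hWS : ∀ v, W v ↔ s(v, p v) ∉ S) :
    (A.submatrix ((↑) : {v // W v} → V) (↑)).det ≠ 0 := by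
  have hW : ∀ v, W (hinv.toPerm p v) ↔ W v := fun v => by
    simp only [hWS, Function.Involutive.coe_toPerm, hinv v, Sym2.eq_swap (a := p v)]
  set q : Equiv.Perm {v // W v} := (hinv.toPerm p).subtypePerm hW
  have hq : ∀ v : {v // W v}, (q v : V) = p v := fun v => rfl
  have hGp : ∀ v, G.Adj v (p v) := fun v => M.adj_sub ((hp _ _).2 rfl)
  have key : ∀ σ : Equiv.Perm {v // W v}, (∀ v, A (σ v) v ≠ 0) → σ = q := by
    intro σ hσ
    set τ : Equiv.Perm V := Equiv.Perm.ofSubtype (σ * q) * hinv.toPerm p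
    have hτW : ∀ v : {v // W v}, τ v = σ v := fun v => by
      have h : hinv.toPerm p (v : V) = q v := rfl
      have hqq : q (q v) = v := Subtype.ext (hinv v)
      rw [Equiv.Perm.mul_apply, h, Equiv.Perm.ofSubtype_apply_coe, Equiv.Perm.mul_apply, hqq]
    have hτS : ∀ v, s(v, p v) ∈ S → τ v = p v := fun v hv =>
      Equiv.Perm.ofSubtype_apply_of_not_mem _ fun h => (hWS v).1 ((hW v).1 h) hv
    have hτG : ∀ v, G.Adj v (τ v) := fun v => by
      by_cases hv : W v
      · rw [hτW ⟨v, hv⟩]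
        exact ((hA _ _).1 (hσ ⟨v, hv⟩)).symm
      · rw [hτS v (not_not.1 fun h => hv ((hWS v).2 h))]
        exact hGp v
    refine Equiv.ext fun v => Subtype.ext ?_
    rw [← hτW, hq, perm_eq_of_forcing hc hp hSM hS hτG hτS]
  rw [Matrix.det_apply, Finset.sum_eq_single q]
  · rw [Units.smul_def, zsmul_eq_mul]
    refine mul_ne_zero ?_ (Finset.prod_ne_zero_iff.2 fun v _ => (hA _ _).2 (hGp v).symm)
    rcases Int.units_eq_one_or (Equiv.Perm.sign q) with h | h <;> simp [h]
  · intro σ _ hσ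
    obtain ⟨v, hv⟩ : ∃ v, A (σ v) v = 0 := by
      by_contra! h
      exact hσ (key σ h)
    rw [Finset.prod_eq_zero (Finset.mem_univ v) (by simpa using hv), smul_zero]
  · simp

/-- A set of edges of size `k` covers at most `2 * k` vertices. -/
theorem card_mem_edge_le [Fintype V] (p : V → V) (S : Set (Sym2 V))
    [DecidablePred fun v => s(v, p v) ∈ S] :
    Fintype.card {v // s(v, p v) ∈ S} ≤ 2 * S.ncard := by
  classical
  have hS := S.toFinite
  rw [Fintype.card_subtype, Set.ncard_eq_toFinset_card S hS, mul_comm]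
  refine (Finset.card_le_card (t := hS.toFinset.biUnion Sym2.toFinset) fun v hv => ?_).trans
    (Finset.card_biUnion_le_card_mul _ _ _ fun e _ => ?_)
  · simp only [Finset.mem_filter, Finset.mem_univ, true_and] at hv
    exact Finset.mem_biUnion.2 ⟨s(v, p v), by simpa using hv, by simp⟩
  · rw [Sym2.card_toFinset]
    split_ifs <;> omega

/-- The number of vertices is at most the rank plus twice the size of a forcing set. -/
theorem Subgraph.card_le_rank_add_of_forcing {F : Type*} [Fintype V] [Field F]
    {c : V → Bool} (hc : ∀ u v, G.Adj u v → c u ≠ c v)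
    {A : Matrix V V F} (hA : ∀ u v, A u v ≠ 0 ↔ G.Adj u v)
    {M : G.Subgraph} (hM : M.IsPerfectMatching) {S : Set (Sym2 V)} (hSM : S ⊆ M.edgeSet)
    (hS : ∀ M' : G.Subgraph, M'.IsPerfectMatching → S ⊆ M'.edgeSet → M' = M) :
    Fintype.card V ≤ A.rank + 2 * S.ncard := by
  classical
  obtain ⟨p, hinv, hp⟩ := hM.exists_involutive
  have hdet := det_submatrix_ne_zero_of_forcing hc hA hinv hp hSM hS fun _ => Iff.rfl
  have hrank := Matrix.rank_of_isUnit _ ((Matrix.isUnit_iff_isUnit_det _).2 hdet.isUnit)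
  have hle := A.rank_submatrix_le ((↑) : {v // s(v, p v) ∉ S} → V)
    ((↑) : {v // s(v, p v) ∉ S} → V)
  have hcard := card_mem_edge_le p S
  have hcompl := Fintype.card_subtype_compl fun v => s(v, p v) ∈ S
  omega

end SimpleGraph

theorem exists_forcing_ncard_eq_forcingNumber {V : Type*} {G : SimpleGraph V} {M : G.Subgraph}
    (hM : M.IsPerfectMatching) :
    ∃ S : Set (Sym2 V), S ⊆ M.edgeSet ∧ S.ncard = forcingNumber G M ∧
      ∀ M' : G.Subgraph, M'.IsPerfectMatching → S ⊆ M'.edgeSet → M' = M :=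
  Nat.sInf_mem (s := {c | ∃ S : Set (Sym2 V), S ⊆ M.edgeSet ∧ S.ncard = c ∧
    ∀ M' : G.Subgraph, M'.IsPerfectMatching → S ⊆ M'.edgeSet → M' = M})
    ⟨_, M.edgeSet, subset_rfl, rfl, fun _ => hM.eq_of_edgeSet_subset_s2⟩

theorem exists_forcingNumber_eq_minForcingNumber {V : Type*} {G : SimpleGraph V}
    (hpm : ∃ M : G.Subgraph, M.IsPerfectMatching) :
    ∃ M : G.Subgraph, M.IsPerfectMatching ∧ forcingNumber G M = minForcingNumber G :=
  let ⟨M, hM⟩ := hpm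
  Nat.sInf_mem (s := {c | ∃ M : G.Subgraph, M.IsPerfectMatching ∧ forcingNumber G M = c})
    ⟨_, M, hM, rfl⟩

theorem stmt2 {V F : Type*} [Fintype V] [DecidableEq V] [Field F]
    (G : SimpleGraph V)
    (hbip : ∃ c : V → Bool, ∀ u v, G.Adj u v → c u ≠ c v)
    (hpm : ∃ M : G.Subgraph, M.IsPerfectMatching)
    (A : Matrix V V F) (hA : ∀ u v, A u v ≠ 0 ↔ G.Adj u v) :
    ((Fintype.card V : ℝ) - A.rank) / 2 ≤ (minForcingNumber G : ℝ) := by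
  obtain ⟨c, hc⟩ := hbip
  obtain ⟨M, hM, hMmin⟩ := exists_forcingNumber_eq_minForcingNumber hpm
  obtain ⟨S, hSM, hScard, hS⟩ := exists_forcing_ncard_eq_forcingNumber hM
  have h := Subgraph.card_le_rank_add_of_forcing hc hA hM hSM hS
  rw [hScard, hMmin] at h
  have h' : (Fintype.card V : ℝ) ≤ A.rank + 2 * minForcingNumber G := by exact_mod_cast h
  linarith
end

section
/- Let G be a finite simple bipartite graph with a perfect matching, with bipartition (X,Y), and let B be a weighted bi-adjacency matrix of G over a field F. Then f(G) ≥ (|V(G)| − 2·rank(B))/2, i.e. the minimum forcing number of G is at least the corank of B. -/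
open SimpleGraph

open Finset in
/-- A square matrix with nonzero diagonal whose support contains no other transversal is
nonsingular. -/
theorem Matrix.det_ne_zero_of_unique_transversal {n F : Type*} [Fintype n] [DecidableEq n]
    [Field F] (C : Matrix n n F) (hdiag : ∀ i, C i i ≠ 0)
    (huniq : ∀ τ : Equiv.Perm n, (∀ i, C i (τ i) ≠ 0) → τ = 1) : C.det ≠ 0 := by
  rw [← Matrix.det_transpose, Matrix.det_apply, Fintype.sum_eq_single 1]
  · simpa using prod_ne_zero_iff.2 fun i _ => hdiag i
  · intro τ hτ
    obtain ⟨i, hi⟩ : ∃ i, C i (τ i) = 0 := by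
      by_contra! h
      exact hτ (huniq τ h)
    rw [prod_eq_zero (mem_univ i) (by simpa using hi), smul_zero]

/-- The edges `x — e x` as a subgraph of a graph on `X ⊕ Y`. -/
def SimpleGraph.equivMatching {X Y : Type*} (G : SimpleGraph (X ⊕ Y)) (e : X ≃ Y)
    (he : ∀ x, G.Adj (Sum.inl x) (Sum.inr (e x))) : G.Subgraph where
  verts := Set.univ
  Adj u v := ∃ x, (u = Sum.inl x ∧ v = Sum.inr (e x)) ∨ (v = Sum.inl x ∧ u = Sum.inr (e x))
  adj_sub := by
    rintro u v ⟨x, ⟨rfl, rfl⟩ | ⟨rfl, rfl⟩⟩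
    exacts [he x, (he x).symm]
  edge_vert _ := Set.mem_univ _
  symm := ⟨fun _ _ ⟨x, hx⟩ => ⟨x, hx.symm⟩⟩

theorem SimpleGraph.isPerfectMatching_equivMatching {X Y : Type*} (G : SimpleGraph (X ⊕ Y))
    (e : X ≃ Y) (he : ∀ x, G.Adj (Sum.inl x) (Sum.inr (e x))) :
    (G.equivMatching e he).IsPerfectMatching := by
  rw [Subgraph.isPerfectMatching_iff]
  rintro (x | y)
  · exact ⟨Sum.inr (e x), ⟨x, Or.inl ⟨rfl, rfl⟩⟩, by rintro _ ⟨x', ⟨h, rfl⟩ | ⟨_, h⟩⟩ <;> simp_all⟩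
  · refine ⟨Sum.inl (e.symm y), ⟨e.symm y, Or.inr ⟨rfl, by simp⟩⟩, ?_⟩
    rintro _ ⟨x', ⟨h, rfl⟩ | ⟨rfl, h⟩⟩ <;> simp_all

theorem SimpleGraph.Subgraph.IsPerfectMatching.exists_equiv {X Y : Type*}
    {G : SimpleGraph (X ⊕ Y)} (hbip : ∀ u v, G.Adj u v → u.isLeft ≠ v.isLeft) {M : G.Subgraph}
    (hM : M.IsPerfectMatching) :
    ∃ e : X ≃ Y, ∀ x y, M.Adj (Sum.inl x) (Sum.inr y) ↔ e x = y := by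
  rw [isPerfectMatching_iff] at hM
  have hl : ∀ x, ∃ y, M.Adj (Sum.inl x) (Sum.inr y) := fun x => by
    obtain ⟨x' | y, h, -⟩ := hM (Sum.inl x)
    · simpa using hbip _ _ h.adj_sub
    · exact ⟨y, h⟩
  have hr : ∀ y, ∃ x, M.Adj (Sum.inl x) (Sum.inr y) := fun y => by
    obtain ⟨x | y', h, -⟩ := hM (Sum.inr y)
    · exact ⟨x, h.symm⟩
    · simpa using hbip _ _ h.adj_sub
  choose f hf using hl
  choose g hg using hr
  have hf' : ∀ x y, M.Adj (Sum.inl x) (Sum.inr y) → f x = y := fun x y h =>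
    Sum.inr_injective ((hM _).unique (hf x) h)
  have hg' : ∀ x y, M.Adj (Sum.inl x) (Sum.inr y) → g y = x := fun x y h =>
    Sum.inl_injective ((hM _).unique (hg y).symm h.symm)
  exact ⟨⟨f, g, fun x => hg' _ _ (hf x), fun y => hf' _ _ (hg y)⟩,
    fun x y => ⟨hf' x y, by rintro rfl; exact hf x⟩⟩

/-- A forcing set together with the rank of a weighted bi-adjacency matrix covers one side of the
bipartition. -/
theorem card_le_rank_add_ncard_of_forcing {X Y F : Type*} [Fintype X] [Fintype Y] [Field F]
    {G : SimpleGraph (X ⊕ Y)} (hbip : ∀ u v, G.Adj u v → u.isLeft ≠ v.isLeft)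
    {B : Matrix X Y F} (hB : ∀ x y, B x y ≠ 0 ↔ G.Adj (Sum.inl x) (Sum.inr y))
    {M : G.Subgraph} (hM : M.IsPerfectMatching) {S : Set (Sym2 (X ⊕ Y))} (hS : S ⊆ M.edgeSet)
    (hforce : ∀ M' : G.Subgraph, M'.IsPerfectMatching → S ⊆ M'.edgeSet → M' = M) :
    Fintype.card X ≤ B.rank + S.ncard := by
  classical
  obtain ⟨σ, hσ⟩ := hM.exists_equiv hbip
  set φ : X → Sym2 (X ⊕ Y) := fun x => s(Sum.inl x, Sum.inr (σ x)) with hφ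
  have hφ_inj : Function.Injective φ := fun x x' h => by simpa [hφ] using h
  let C : Matrix {x // φ x ∉ S} {x // φ x ∉ S} F := B.submatrix (↑) (fun x => σ x)
  have hdiag : ∀ x, B x (σ x) ≠ 0 := fun x => (hB _ _).2 ((hσ _ _).2 rfl).adj_sub
  have hdet : C.det ≠ 0 := by
    refine C.det_ne_zero_of_unique_transversal (fun x => hdiag x) fun τ hτ => ?_
    let e : X ≃ Y := (Equiv.Perm.ofSubtype τ).trans σ
    have he_mem : ∀ x, φ x ∈ S → e x = σ x := fun x hx => by
      simp [e, Equiv.Perm.ofSubtype_apply_of_not_mem τ (not_not.2 hx)]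
    have he_sub : ∀ x : {x // φ x ∉ S}, e x = σ (τ x) := fun x => by simp [e]
    have he : ∀ x, G.Adj (Sum.inl x) (Sum.inr (e x)) := fun x => by
      rw [← hB]
      by_cases hx : φ x ∈ S
      · rw [he_mem x hx]
        exact hdiag x
      · rw [he_sub ⟨x, hx⟩]
        exact hτ ⟨x, hx⟩
    have hsub : S ⊆ (G.equivMatching e he).edgeSet := fun s hs => by
      obtain ⟨x, rfl⟩ : ∃ x, φ x = s := by
        have hsM := hS hs
        induction s with
        | h u v =>
          rw [Subgraph.mem_edgeSet] at hsM
          rcases u with x | y <;> rcases v with x' | y'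
          · simpa using hbip _ _ hsM.adj_sub
          · exact ⟨x, by simp [hφ, (hσ _ _).1 hsM]⟩
          · exact ⟨x', by simp [hφ, (hσ _ _).1 hsM.symm]⟩
          · simpa using hbip _ _ hsM.adj_sub
      exact Subgraph.mem_edgeSet.2 ⟨x, Or.inl ⟨rfl, by rw [he_mem x hs]⟩⟩
    have hM' := hforce _ (G.isPerfectMatching_equivMatching e he) hsub
    ext x
    have hx : M.Adj (Sum.inl x) (Sum.inr (e x)) := hM' ▸ ⟨x, Or.inl ⟨rfl, rfl⟩⟩
    rw [hσ, he_sub] at hx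
    exact (σ.injective hx).symm
  have hrank : Fintype.card {x // φ x ∉ S} ≤ B.rank := by
    rw [← Matrix.rank_of_isUnit C ((Matrix.isUnit_iff_isUnit_det C).2 hdet.isUnit)]
    exact B.rank_submatrix_le _ _
  have hcard : Fintype.card {x // φ x ∈ S} ≤ S.ncard := by
    rw [← Nat.card_eq_fintype_card, ← Nat.card_coe_set_eq]
    exact Nat.card_le_card_of_injective (fun x => (⟨φ x, x.2⟩ : S)) fun x x' h =>
      Subtype.ext (hφ_inj (congrArg Subtype.val h))
  have := Fintype.card_subtype_compl (fun x => φ x ∈ S)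
  omega

theorem stmt3 {X Y F : Type*} [Fintype X] [Fintype Y] [DecidableEq X] [DecidableEq Y] [Field F]
    (G : SimpleGraph (X ⊕ Y))
    (hbip : ∀ u v, G.Adj u v → u.isLeft ≠ v.isLeft)
    (hpm : ∃ M : G.Subgraph, M.IsPerfectMatching)
    (B : Matrix X Y F) (hB : ∀ x y, B x y ≠ 0 ↔ G.Adj (Sum.inl x) (Sum.inr y)) :
    ((Fintype.card (X ⊕ Y) : ℝ) - 2 * B.rank) / 2 ≤ (minForcingNumber G : ℝ) := by
  obtain ⟨M, hM, hMf⟩ := Nat.sInf_mem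
    (s := {c | ∃ M : G.Subgraph, M.IsPerfectMatching ∧ forcingNumber G M = c})
    (hpm.imp' (forcingNumber G) fun M hM => ⟨M, hM, rfl⟩)
  obtain ⟨S, hS, hSc, hforce⟩ := Nat.sInf_mem
    (s := {c | ∃ S : Set (Sym2 (X ⊕ Y)), S ⊆ M.edgeSet ∧ S.ncard = c ∧
      ∀ M' : G.Subgraph, M'.IsPerfectMatching → S ⊆ M'.edgeSet → M' = M})
    ⟨_, M.edgeSet, subset_rfl, rfl, fun M' hM' h => hM.eq_of_edgeSet_subset hM' h⟩
  have hle := card_le_rank_add_ncard_of_forcing hbip hB hM hS hforce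
  have hc : S.ncard = minForcingNumber G := hSc.trans hMf
  obtain ⟨σ, -⟩ := hM.exists_equiv hbip
  rw [hc] at hle
  have hle' : (Fintype.card X : ℝ) ≤ B.rank + minForcingNumber G := mod_cast hle
  rw [Fintype.card_sum, ← Fintype.card_congr σ]
  push_cast
  linarith
end

section
/- Let G be a finite simple bipartite graph on n vertices that admits an involutory weighted adjacency matrix over some field F, and let k ≥ 2 be an integer. Then the minimum forcing number of the circular graph G □ C_{2k} satisfies f(G □ C_{2k}) = n. -/
open SimpleGraph

namespace SimpleGraph.Subgraph

variable {V : Type*} {G : SimpleGraph V}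

/-- The perfect matching pairing each vertex with its image under an involution. -/
def ofInvolution (m : V → V) (hm : Function.Involutive m) (hadj : ∀ v, G.Adj v (m v)) :
    G.Subgraph where
  verts := Set.univ
  Adj u v := m u = v
  adj_sub := by rintro u v rfl; exact hadj u
  edge_vert _ := Set.mem_univ _
  symm := by
    constructor
    rintro u v rfl
    exact hm u

theorem isPerfectMatching_ofInvolution (m : V → V) (hm : Function.Involutive m)
    (hadj : ∀ v, G.Adj v (m v)) : (ofInvolution m hm hadj).IsPerfectMatching :=
  isPerfectMatching_iff.2 fun v => ⟨m v, rfl, fun _ h => Eq.symm h⟩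

theorem IsPerfectMatching.exists_involution {M : G.Subgraph} (hM : M.IsPerfectMatching) :
    ∃ m : V → V, Function.Involutive m ∧ ∀ u v, M.Adj u v ↔ m u = v := by
  choose m hm huniq using isPerfectMatching_iff.1 hM
  exact ⟨m, fun v => (huniq _ _ (hm v).symm).symm,
    fun u v => ⟨fun h => (huniq _ _ h).symm, by rintro rfl; exact hm u⟩⟩

theorem IsPerfectMatching.eq_of_adj_imp {M M' : G.Subgraph} (hM : M.IsPerfectMatching)
    (hM' : M'.IsPerfectMatching) (h : ∀ u v, M.Adj u v → M'.Adj u v) : M' = M := by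
  obtain ⟨m, -, hm⟩ := hM.exists_involution
  obtain ⟨m', -, hm'⟩ := hM'.exists_involution
  refine Subgraph.ext ?_ ?_
  · rw [isSpanning_iff.1 hM.2, isSpanning_iff.1 hM'.2]
  · funext u v
    have := (hm' _ _).1 (h u (m u) ((hm _ _).2 rfl))
    rw [hm, hm', this]

end SimpleGraph.Subgraph

theorem Bool.eq_of_ne_of_ne {a b c : Bool} (hb : a ≠ b) (hc : a ≠ c) : b = c := by
  revert a b c
  decide

/-- A self-map of a finite type preserving a nonempty set agrees with some permutation on a
nonempty subset, outside which the permutation is the identity. -/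
theorem exists_perm_eq_or_eq_self {α : Type*} [Finite α] (T : Set α) (hT : T.Nonempty)
    (g : α → α) (hg : ∀ a ∈ T, g a ∈ T) :
    ∃ σ : Equiv.Perm α, (∃ a ∈ T, σ a = g a) ∧ ∀ a, σ a = a ∨ (a ∈ T ∧ σ a = g a) := by
  classical
  let P : Set α := Function.periodicPts g ∩ T
  obtain ⟨a, ha⟩ := hT
  have hit : ∀ (n : ℕ) (b : α), b ∈ T → g^[n] b ∈ T := fun n => by
    induction n with
    | zero => exact fun b hb => hb
    | succ n ih => exact fun b hb => ih _ (hg b hb)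
  have hmaps : Set.MapsTo g P P := fun b hb =>
    ⟨(Function.bijOn_periodicPts g).mapsTo hb.1, hg b hb.2⟩
  have hinj : Set.InjOn g P := (Function.bijOn_periodicPts g).injOn.mono Set.inter_subset_left
  have hbij : Function.Bijective (hmaps.restrict g P P) :=
    Finite.injective_iff_bijective.1 ((Set.MapsTo.restrict_inj hmaps).2 hinj)
  obtain ⟨p, hp⟩ : P.Nonempty := by
    obtain ⟨i, j, hij, h⟩ := Finite.exists_ne_map_eq_of_infinite (fun n : ℕ => g^[n] a)
    wlog hlt : i < j generalizing i j
    · exact this j i hij.symm h.symm (by omega)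
    refine ⟨g^[i] a, Function.mk_mem_periodicPts (n := j - i) (by omega) ?_, hit i a ha⟩
    change g^[j - i] (g^[i] a) = g^[i] a
    rw [← Function.iterate_add_apply, Nat.sub_add_cancel hlt.le]
    exact h.symm
  let τ : Equiv.Perm P := Equiv.ofBijective _ hbij
  have hτ : ∀ b (hb : b ∈ P), Equiv.Perm.ofSubtype τ b = g b := fun b hb => by
    rw [Equiv.Perm.ofSubtype_apply_of_mem τ hb]
    rfl
  refine ⟨Equiv.Perm.ofSubtype τ, ⟨p, hp.2, hτ p hp⟩, fun b => ?_⟩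
  by_cases hb : b ∈ P
  · exact Or.inr ⟨hb.2, hτ b hb⟩
  · exact Or.inl (Equiv.Perm.ofSubtype_apply_of_not_mem τ hb)

/-- In a bipartite graph, let `T` be a set of vertices avoiding a forcing set of a perfect matching,
such that no vertex has exactly one neighbour in `T`. Then `T` is empty. -/
theorem eq_empty_of_forcing {V : Type*} [Finite V] {H : SimpleGraph V} (c : H.Coloring Bool)
    {M : H.Subgraph} (hM : M.IsPerfectMatching) {S : Set (Sym2 V)} (hS : S ⊆ M.edgeSet)
    (hforce : ∀ M' : H.Subgraph, M'.IsPerfectMatching → S ⊆ M'.edgeSet → M' = M)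
    (T : Set V) (hT : ∀ x, ∀ y ∈ T, H.Adj x y → ∃ y' ∈ T, y' ≠ y ∧ H.Adj x y')
    (hTS : ∀ e ∈ S, ∀ v ∈ e, v ∉ T) : T = ∅ := by
  classical
  by_contra hne
  obtain ⟨t, ht⟩ := Set.nonempty_iff_ne_empty.2 hne
  obtain ⟨m, hinv, hm⟩ := hM.exists_involution
  have hadj : ∀ v, H.Adj v (m v) := fun v => M.adj_sub ((hm _ _).2 rfl)
  choose! g hgT hgne hgadj using fun y (hy : y ∈ T) => hT (m y) y hy (hadj y).symm
  have hcol : ∀ u v w, H.Adj u v → H.Adj u w → c v = c w := fun u v w h h' =>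
    Bool.eq_of_ne_of_ne (c.valid h) (c.valid h')
  have hgc : ∀ y ∈ T, c (g y) = c y := fun y hy => hcol _ _ _ (hgadj y hy) (hadj y).symm
  obtain ⟨σ, ⟨a, ⟨haT, hac⟩, ha⟩, hσ⟩ := exists_perm_eq_or_eq_self {y | y ∈ T ∧ c y = c t}
    ⟨t, ht, rfl⟩ g fun y hy => ⟨hgT y hy.1, (hgc y hy.1).trans hy.2⟩
  have hσc : ∀ v, c (σ v) = c v := fun v => by
    rcases hσ v with h | ⟨h, h'⟩
    · rw [h]
    · rw [h', hgc v h.1]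
  have hσadj : ∀ v, H.Adj (m v) (σ v) := fun v => by
    rcases hσ v with h | ⟨h, h'⟩
    · rw [h]; exact (hadj v).symm
    · rw [h']; exact hgadj v h.1
  have hσS : ∀ v, v ∉ T → σ v = v := fun v hv => (hσ v).resolve_right fun h => hv h.1.1
  have hσc' : ∀ v, c (σ.symm v) = c v := fun v => by
    rw [← hσc (σ.symm v), Equiv.apply_symm_apply]
  have hmc : ∀ v, c v ≠ c (m v) := fun v => c.valid (hadj v)
  let m' : V → V := fun v => if c v = c t then m (σ.symm v) else σ (m v)
  have hm'_pos : ∀ v, c v = c t → m' v = m (σ.symm v) := fun v hv => if_pos hv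
  have hm'_neg : ∀ v, c v ≠ c t → m' v = σ (m v) := fun v hv => if_neg hv
  have hinv' : Function.Involutive m' := fun v => by
    by_cases hv : c v = c t
    · have h1 := hmc (σ.symm v)
      rw [hσc', hv] at h1
      rw [hm'_pos v hv, hm'_neg _ h1.symm, hinv, Equiv.apply_symm_apply]
    · have h1 : c (σ (m v)) = c t := by
        rw [hσc]
        exact Bool.eq_of_ne_of_ne (hmc v) hv
      rw [hm'_neg v hv, hm'_pos _ h1, Equiv.symm_apply_apply, hinv]
  have hadj' : ∀ v, H.Adj v (m' v) := fun v => by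
    by_cases hv : c v = c t
    · rw [hm'_pos v hv]
      simpa using (hσadj (σ.symm v)).symm
    · rw [hm'_neg v hv]
      simpa [hinv v] using hσadj (m v)
  have hEq := hforce _ (Subgraph.isPerfectMatching_ofInvolution m' hinv' hadj') ?_
  · have h1 : M.Adj (m a) (m' (m a)) := by
      rw [← hEq]
      exact rfl
    have h2 : c (m a) ≠ c t := fun h => hmc a (hac.trans h.symm)
    rw [hm, hm'_neg _ h2, hinv, ha] at h1
    exact hgne a haT h1.symm
  · intro e he
    induction e with
    | _ u v =>
      have huv : m u = v := (hm u v).1 (hS he)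
      have hu := hσS u (hTS _ he u (Sym2.mem_mk_left u v))
      have hv := hσS v (hTS _ he v (Sym2.mem_mk_right u v))
      change m' u = v
      by_cases h : c u = c t
      · rw [hm'_pos u h, σ.symm_apply_eq.2 hu.symm, huv]
      · rw [hm'_neg u h, huv, hv]

/-- If a space of weights on the vertices of a bipartite graph is such that no vertex has exactly
one neighbour with nonzero weight, then its dimension is at most twice the size of any forcing
set. -/
theorem finrank_le_two_mul_ncard_of_forcing {V K E : Type*} [Fintype V] [Field K] [AddCommGroup E]
    [Module K E] {H : SimpleGraph V} (c : H.Coloring Bool)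
    {M : H.Subgraph} (hM : M.IsPerfectMatching) {S : Set (Sym2 V)} (hS : S ⊆ M.edgeSet)
    (hforce : ∀ M' : H.Subgraph, M'.IsPerfectMatching → S ⊆ M'.edgeSet → M' = M)
    (Φ : E →ₗ[K] V → K) (hΦ : Function.Injective Φ)
    (hker : ∀ e x y, H.Adj x y → Φ e y ≠ 0 → ∃ y', y' ≠ y ∧ H.Adj x y' ∧ Φ e y' ≠ 0) :
    Module.finrank K E ≤ 2 * S.ncard := by
  classical
  let U : Finset V := S.toFinset.biUnion Sym2.toFinset
  have hU : U.card ≤ 2 * S.ncard := by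
    rw [mul_comm, Set.ncard_eq_toFinset_card']
    refine Finset.card_biUnion_le_card_mul _ _ _ fun e _ => ?_
    induction e with
    | _ u v => rw [Sym2.toFinset_mk_eq]; exact Finset.card_le_two
  let Ψ : E →ₗ[K] U → K := LinearMap.funLeft K K Subtype.val ∘ₗ Φ
  have hΨ : Function.Injective Ψ := by
    rw [← LinearMap.ker_eq_bot, LinearMap.ker_eq_bot']
    intro e he
    have hempty := eq_empty_of_forcing c hM hS hforce {v | Φ e v ≠ 0}
      (fun x y hy hxy => by
        obtain ⟨y', h1, h2, h3⟩ := hker e x y hxy hy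
        exact ⟨y', h3, h1, h2⟩)
      (fun s hs v hv hne => hne <| congrFun he
        ⟨v, Finset.mem_biUnion.2 ⟨s, Set.mem_toFinset.2 hs, Sym2.mem_toFinset.2 hv⟩⟩)
    apply hΦ
    rw [map_zero]
    funext v
    by_contra hv
    exact (Set.ext_iff.1 hempty v).1 hv
  calc Module.finrank K E ≤ Module.finrank K (U → K) := LinearMap.finrank_le_finrank_of_injective hΨ
    _ = U.card := by simp
    _ ≤ 2 * S.ncard := hU

theorem Fin.add_one_add_one_ne {n : ℕ} (hn : 1 ≤ n) (i : Fin (n + 2)) :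
    i + 1 + 1 ≠ i := fun h => by
  rw [add_assoc, add_eq_left] at h
  have h' := congrArg Fin.val h
  rw [Fin.val_add, Fin.val_one, Nat.mod_eq_of_lt (by omega)] at h'
  simp at h'

open scoped Matrix in
theorem card_le_ncard_of_forcing_boxProd_cycleGraph {V K : Type*} [Fintype V] [DecidableEq V]
    [Field K] [Infinite K] {G : SimpleGraph V} (c : G.Coloring Bool)
    (A : Matrix V V K) (hA : ∀ u v, A u v ≠ 0 ↔ G.Adj u v) (hinv : A * A = 1)
    {n : ℕ} (hn : 2 ≤ n) (χ : Fin (n + 2) → Bool) (hχ : ∀ i, χ (i + 1) = !χ i)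
    {M : (G □ cycleGraph (n + 2)).Subgraph} (hM : M.IsPerfectMatching)
    {S : Set (Sym2 (V × Fin (n + 2)))} (hS : S ⊆ M.edgeSet)
    (hforce : ∀ M' : (G □ cycleGraph (n + 2)).Subgraph,
      M'.IsPerfectMatching → S ⊆ M'.edgeSet → M' = M) :
    Fintype.card V ≤ S.ncard := by
  have hχ' : ∀ i, χ (i - 1) = !χ i := fun i => by
    have := hχ (i - 1)
    rw [sub_add_cancel] at this
    rw [this, Bool.not_not]
  have hcyc : ∀ i j, (cycleGraph (n + 2)).Adj i j ↔ j = i + 1 ∨ j = i - 1 := fun i j => by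
    rw [cycleGraph_adj, or_comm, sub_eq_iff_eq_add', sub_eq_iff_eq_add', eq_sub_iff_add_eq,
      eq_comm (a := i)]
  let C : (G □ cycleGraph (n + 2)).Coloring Bool := Coloring.mk (fun x => c x.1 ^^ χ x.2) <| by
    rintro ⟨u, i⟩ ⟨v, j⟩ h
    rw [boxProd_adj] at h
    rcases h with ⟨h, rfl⟩ | ⟨h, rfl⟩
    · simpa using c.valid h
    · rcases (hcyc _ _).1 h with rfl | rfl
      · simp [hχ]
      · simp [hχ']
  let t : Fin (n + 2) → K := fun i => Infinite.natEmbedding K i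
  have ht : Function.Injective t := fun i j h => Fin.ext ((Infinite.natEmbedding K).injective h)
  have h1 : ∀ i : Fin (n + 2), i + 1 ≠ i := fun i h => by simp at h
  have h2 : ∀ i : Fin (n + 2), i - 1 ≠ i := fun i h => by simp at h
  have h3 : ∀ i : Fin (n + 2), i + 1 ≠ i - 1 := fun i h =>
    Fin.add_one_add_one_ne (by omega) i (eq_sub_iff_add_eq.1 h)
  let B : Bool → Matrix V V K := fun b => bif b then 1 else A
  have hB : ∀ b, A * B b = B !b := by rintro (_ | _) <;> simp [B, hinv]
  have hBinj : ∀ b (x : V → K), B b *ᵥ x = 0 → x = 0 := fun b x h => by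
    have hBB : B b * B b = 1 := by cases b <;> simp [B, hinv]
    rw [← Matrix.one_mulVec x, ← hBB, ← Matrix.mulVec_mulVec, h, Matrix.mulVec_zero]
  let Φ : ((V → K) × (V → K)) →ₗ[K] V × Fin (n + 2) → K :=
    { toFun := fun p x => (B (χ x.2) *ᵥ (p.1 + t x.2 • p.2)) x.1
      map_add' := fun p q => by
        funext x
        simp only [Prod.fst_add, Prod.snd_add, Pi.add_apply, Pi.smul_apply, smul_eq_mul,
          Matrix.mulVec_add, Matrix.mulVec_smul, smul_add]
        ring
      map_smul' := fun a p => by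
        funext x
        simp only [Prod.smul_fst, Prod.smul_snd, Pi.add_apply, Pi.smul_apply, RingHom.id_apply,
          smul_eq_mul, Matrix.mulVec_add, Matrix.mulVec_smul]
        ring }
  have hΦ : Function.Injective Φ := by
    rw [← LinearMap.ker_eq_bot, LinearMap.ker_eq_bot']
    rintro ⟨p, q⟩ h
    have hz : ∀ i, p + t i • q = 0 := fun i => hBinj (χ i) _ (funext fun v => congrFun h (v, i))
    have hq : (t 1 - t 0) • q = 0 := by
      rw [sub_smul, ← add_sub_add_left_eq_sub _ _ p, hz, hz, sub_zero]
    have hq0 : q = 0 := (smul_eq_zero.1 hq).resolve_left (sub_ne_zero.2 (ht.ne (by simp)))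
    have := hz 0
    rw [hq0, smul_zero, add_zero] at this
    rw [this, hq0]
    rfl
  have hrel : ∀ e v i, (t (i + 1) - t (i - 1)) * ∑ w, A v w * Φ e (w, i)
      + (t (i - 1) - t i) * Φ e (v, i + 1) + (t i - t (i + 1)) * Φ e (v, i - 1) = 0 := by
    rintro ⟨p, q⟩ v i
    have hs : ∑ w, A v w * Φ (p, q) (w, i) = (B (!χ i) *ᵥ (p + t i • q)) v := by
      rw [← hB, ← Matrix.mulVec_mulVec]
      rfl
    rw [hs]
    simp only [Φ, LinearMap.coe_mk, AddHom.coe_mk, hχ, hχ', Matrix.mulVec_add, Matrix.mulVec_smul,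
      Pi.add_apply, Pi.smul_apply, smul_eq_mul]
    ring
  have hker : ∀ e x y, (G □ cycleGraph (n + 2)).Adj x y → Φ e y ≠ 0 →
      ∃ y', y' ≠ y ∧ (G □ cycleGraph (n + 2)).Adj x y' ∧ Φ e y' ≠ 0 := by
    rintro e ⟨v, i⟩ y hxy hy
    by_contra! hcon
    have hzero : ∀ w, (w, i) ≠ y → A v w * Φ e (w, i) = 0 := fun w hw => by
      by_cases hvw : G.Adj v w
      · rw [hcon _ hw (boxProd_adj.2 (Or.inl ⟨hvw, rfl⟩)), mul_zero]
      · rw [not_not.1 (mt (hA v w).1 hvw), zero_mul]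
    have hsucc : (v, i + 1) ≠ y → Φ e (v, i + 1) = 0 := fun h =>
      hcon _ h (boxProd_adj.2 (Or.inr ⟨(hcyc _ _).2 (Or.inl rfl), rfl⟩))
    have hpred : (v, i - 1) ≠ y → Φ e (v, i - 1) = 0 := fun h =>
      hcon _ h (boxProd_adj.2 (Or.inr ⟨(hcyc _ _).2 (Or.inr rfl), rfl⟩))
    have hr := hrel e v i
    obtain ⟨w, j⟩ := y
    rw [boxProd_adj] at hxy
    rcases hxy with ⟨hvw, hij⟩ | ⟨hij, hvw⟩
    · obtain rfl : i = j := hij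
      rw [hsucc (by simp), hpred (by simp [h2]), Finset.sum_eq_single w
        (fun w' _ hw' => hzero w' (by simpa using hw')) (by simp)] at hr
      simp only [mul_zero, add_zero] at hr
      exact mul_ne_zero (sub_ne_zero.2 (ht.ne (h3 i))) (mul_ne_zero ((hA v w).2 hvw) hy) hr
    · obtain rfl : v = w := hvw
      rcases (hcyc _ _).1 hij with hj | hj <;> change j = _ at hj <;> subst hj
      · rw [hpred (by simpa using (h3 i).symm), Finset.sum_eq_zero
          (fun w' _ => hzero w' (by simp))] at hr
        simp only [mul_zero, add_zero, zero_add] at hr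
        exact mul_ne_zero (sub_ne_zero.2 (ht.ne (h2 i))) hy hr
      · rw [hsucc (by simpa using h3 i), Finset.sum_eq_zero
          (fun w' _ => hzero w' (by simp [(h2 i).symm]))] at hr
        simp only [mul_zero, add_zero, zero_add] at hr
        exact mul_ne_zero (sub_ne_zero.2 (ht.ne (h1 i).symm)) hy hr
  have := finrank_le_two_mul_ncard_of_forcing C hM hS hforce Φ hΦ hker
  simp only [Module.finrank_prod, Module.finrank_fintype_fun_eq_card] at this
  omega

theorem exists_forcing_boxProd_cycleGraph {V : Type*} [Fintype V] {G : SimpleGraph V}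
    (c : G.Coloring Bool) {n : ℕ} (hn : 1 ≤ n) (χ : Fin (n + 2) → Bool) (hχ : ∀ i, χ (i + 1) = !χ i) :
    ∃ M : (G □ cycleGraph (n + 2)).Subgraph, M.IsPerfectMatching ∧
      ∃ S ⊆ M.edgeSet, S.ncard ≤ Fintype.card V ∧
        ∀ M' : (G □ cycleGraph (n + 2)).Subgraph,
          M'.IsPerfectMatching → S ⊆ M'.edgeSet → M' = M := by
  classical
  have hχ' : ∀ i, χ (i - 1) = !χ i := fun i => by
    have := hχ (i - 1)
    rw [sub_add_cancel] at this
    rw [this, Bool.not_not]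
  let m : V × Fin (n + 2) → V × Fin (n + 2) :=
    fun x => (x.1, if c x.1 = χ x.2 then x.2 + 1 else x.2 - 1)
  have hm_inv : Function.Involutive m := by
    rintro ⟨v, i⟩
    by_cases h : c v = χ i <;> simp [m, h, hχ, hχ']
  have hm_adj : ∀ x, (G □ cycleGraph (n + 2)).Adj x (m x) := by
    rintro ⟨v, i⟩
    rw [boxProd_adj]
    refine Or.inr ⟨?_, rfl⟩
    by_cases h : c v = χ i <;> simp [m, h, cycleGraph_adj]
  let M := Subgraph.ofInvolution m hm_inv hm_adj
  have hM : M.IsPerfectMatching := Subgraph.isPerfectMatching_ofInvolution m hm_inv hm_adj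
  let s : V → Fin (n + 2) := fun v => if c v = χ 0 then 0 else 1
  have hs : ∀ v, c v = χ (s v) := fun v => by
    by_cases h : c v = χ 0
    · simp [s, h]
    · rw [show s v = 0 + 1 by simp [s, h], hχ]
      exact Bool.eq_not_of_ne h
  refine ⟨M, hM, Set.range fun v => s((v, s v), (v, s v + 1)), ?_, ?_, ?_⟩
  · rintro _ ⟨v, rfl⟩
    change m (v, s v) = (v, s v + 1)
    simp [m, ← hs]
  · rw [← Set.image_univ, ← Nat.card_eq_fintype_card, ← Set.ncard_univ]
    exact Set.ncard_image_le
  · intro M' hM' hS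
    obtain ⟨m', hinv, hm'⟩ := hM'.exists_involution
    have hstart : ∀ v, m' (v, s v) = (v, s v + 1) := fun v => (hm' _ _).1 (hS ⟨v, rfl⟩)
    have hstep : ∀ i : Fin (n + 2), (∀ v, c v = χ i → m' (v, i) = (v, i + 1)) →
        (∀ v, c v = χ (i + 1) → m' (v, i + 1) = (v, i + 1 + 1)) →
        ∀ v, c v = χ (i + 1 + 1) → m' (v, i + 1 + 1) = (v, i + 1 + 1 + 1) := by
      intro i h1 h2 v hv
      have hadj := M'.adj_sub ((hm' (v, i + 1 + 1) _).2 rfl)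
      generalize hy : m' (v, i + 1 + 1) = y at hadj
      have hy' : m' y = (v, i + 1 + 1) := by rw [← hy, hinv]
      obtain ⟨w, j⟩ := y
      rw [boxProd_adj] at hadj
      rcases hadj with ⟨hvw, hij⟩ | ⟨hij, hvw⟩
      · obtain rfl : i + 1 + 1 = j := hij
        have hw : c w = χ (i + 1) := by
          rw [hχ] at hv
          exact Bool.eq_of_ne_of_ne (c.valid hvw) (by rw [hv]; simp)
        have h := congrArg m' (h2 w hw)
        rw [hinv, hy'] at h
        simp at h
      · obtain rfl : v = w := hvw
        change (cycleGraph (n + 2)).Adj (i + 1 + 1) j at hij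
        rw [cycleGraph_adj, sub_eq_iff_eq_add', sub_eq_iff_eq_add'] at hij
        rcases hij with hij | rfl
        · obtain rfl : i + 1 = j := add_right_cancel hij
          have h := congrArg m' (h1 v (by rw [hv, hχ, hχ, Bool.not_not]))
          rw [hinv, hy'] at h
          exact absurd (congrArg Prod.snd h).symm (Fin.add_one_add_one_ne hn i)
        · rfl
    have hall : ∀ j : Fin (n + 2), (∀ v, c v = χ j → m' (v, j) = (v, j + 1)) ∧
        ∀ v, c v = χ (j + 1) → m' (v, j + 1) = (v, j + 1 + 1) := by
      intro j
      induction j using Fin.induction with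
      | zero =>
        constructor <;> intro v hv <;> have h := hstart v
        · rwa [show s v = 0 by simp [s, hv]] at h
        · rw [hχ] at hv
          rwa [show s v = 0 + 1 by simp [s, hv]] at h
      | succ j ih =>
        rw [← Fin.coeSucc_eq_succ]
        exact ⟨ih.2, hstep _ ih.1 ih.2⟩
    refine hM.eq_of_adj_imp hM' ?_
    have hall' : ∀ i v, c v = χ i → m' (v, i) = (v, i + 1) := fun i => (hall i).1
    rintro ⟨v, i⟩ _ rfl
    rw [hm']
    by_cases h : c v = χ i
    · simp [m, h, hall' i v h]
    · have h' := congrArg m' (hall' (i - 1) v (by rw [hχ']; exact Bool.eq_not_of_ne h))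
      rw [hinv, sub_add_cancel] at h'
      simp [m, h, ← h']

theorem stmt5 {V F : Type*} [Fintype V] [DecidableEq V] [Field F]
    (G : SimpleGraph V)
    (hbip : ∃ c : V → Bool, ∀ u v, G.Adj u v → c u ≠ c v)
    (A : Matrix V V F) (hA : ∀ u v, A u v ≠ 0 ↔ G.Adj u v)
    (hinv : A * A = 1)
    (k : ℕ) (hk : 2 ≤ k) :
    minForcingNumber (G □ cycleGraph (2 * k)) = Fintype.card V := by
  obtain ⟨c, hc⟩ := hbip
  obtain ⟨n, hn⟩ : ∃ n, 2 * k = n + 2 := ⟨2 * k - 2, by omega⟩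
  rw [hn]
  let χ : Fin (n + 2) → Bool := fun i => i.val % 2 == 0
  have hχ : ∀ i, χ (i + 1) = !χ i := fun i => by
    simp only [χ, Fin.val_add_one]
    split_ifs with h
    · subst h
      simp only [Fin.val_last]
      grind
    · grind
  let C : G.Coloring Bool := Coloring.mk c fun h => hc _ _ h
  let K := AlgebraicClosure F
  let φ : F →+* K := algebraMap F K
  have hA' : ∀ u v, A.map φ u v ≠ 0 ↔ G.Adj u v := fun u v => by
    rw [← hA, Matrix.map_apply, map_ne_zero]
  have hinv' : A.map φ * A.map φ = 1 := by
    rw [← Matrix.map_mul, hinv, Matrix.map_one _ (map_zero φ) (map_one φ)]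
  obtain ⟨M, hM, S, hS, hcard, hforce⟩ := exists_forcing_boxProd_cycleGraph C (by omega) χ hχ
  apply le_antisymm
  · calc minForcingNumber (G □ cycleGraph (n + 2)) ≤ forcingNumber _ M := Nat.sInf_le ⟨M, hM, rfl⟩
      _ ≤ S.ncard := Nat.sInf_le ⟨S, hS, rfl, hforce⟩
      _ ≤ Fintype.card V := hcard
  · refine le_csInf ⟨_, M, hM, rfl⟩ ?_
    rintro _ ⟨N, hN, rfl⟩
    refine le_csInf ⟨_, N.edgeSet, subset_rfl, rfl, fun M' hM' h => hN.eq_of_adj_imp hM' ?_⟩ ?_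
    · exact fun u v huv => Subgraph.mem_edgeSet.1 (h (Subgraph.mem_edgeSet.2 huv))
    · rintro _ ⟨T, hT, rfl, hTforce⟩
      exact card_le_ncard_of_forcing_boxProd_cycleGraph C _ hA' hinv' (by omega) χ hχ hN hT hTforce
end

section
/- Let G be a finite simple bipartite graph on n vertices with bipartition (X,Y) and let k ≥ 2 be an integer. In G □ C_{2k}, the matching that joins every vertex of the first copy X_1 of X to its corresponding vertex in the second copy X_2, and every vertex of the first copy Y_1 of Y to its corresponding vertex in the 2k-th copy Y_{2k}, extends to a unique perfect matching of G □ C_{2k}; consequently f(G □ C_{2k}) ≤ n. -/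
open SimpleGraph

lemma cycleGraph_adj_iff_val {n : ℕ} (hn : 2 ≤ n) (i j : Fin n) :
    (cycleGraph n).Adj i j ↔ j.val = i.val + 1 ∨ i.val = j.val + 1 ∨
      (i.val = 0 ∧ j.val = n - 1) ∨ (j.val = 0 ∧ i.val = n - 1) := by
  rw [cycleGraph_adj', Fin.sub_def, Fin.sub_def]
  have hi := i.isLt
  have hj := j.isLt
  simp only
  rcases lt_trichotomy i.val j.val with h | h | h
  · rw [Nat.mod_eq_of_lt (a := n - j.val + i.val) (by omega),
      Nat.mod_eq_sub_mod (a := n - i.val + j.val) (by omega), Nat.mod_eq_of_lt (by omega)]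
    omega
  · rw [h, show n - j.val + j.val = n by omega, Nat.mod_self]
    omega
  · rw [Nat.mod_eq_of_lt (a := n - i.val + j.val) (by omega),
      Nat.mod_eq_sub_mod (a := n - j.val + i.val) (by omega), Nat.mod_eq_of_lt (by omega)]
    omega

/-- In the fiber over a vertex of `X` the matching uses the edges `{2i, 2i + 1}` of the cycle
of length `n`; in the other fibers it uses the complementary perfect matching of the cycle. -/
def IsAlternatingPair {V : Type*} (X : Set V) (n : ℕ) (v : V) (i j : ℕ) : Prop :=
  (j = i + 1 ∧ (v ∈ X ↔ i % 2 = 0)) ∨ (i = j + 1 ∧ (v ∈ X ↔ j % 2 = 0)) ∨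
    (v ∉ X ∧ ((i = 0 ∧ j = n - 1) ∨ (j = 0 ∧ i = n - 1)))

lemma IsAlternatingPair.symm {V : Type*} {X : Set V} {n : ℕ} {v : V} {i j : ℕ}
    (h : IsAlternatingPair X n v i j) : IsAlternatingPair X n v j i := by
  unfold IsAlternatingPair at *
  tauto

/-- The perfect matching of `G □ cycleGraph (2 * k)` that alternates along each cycle fiber. -/
def alternatingMatching {V : Type*} (G : SimpleGraph V) (X : Set V) (k : ℕ) (hk : 2 ≤ k) :
    (G □ cycleGraph (2 * k)).Subgraph where
  verts := Set.univ
  Adj a b := a.1 = b.1 ∧ IsAlternatingPair X (2 * k) a.1 a.2.val b.2.val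
  adj_sub := by
    rintro ⟨v, i⟩ ⟨w, j⟩ ⟨rfl, h⟩
    rw [boxProd_adj]
    refine Or.inr ⟨(cycleGraph_adj_iff_val (by omega) i j).2 ?_, rfl⟩
    unfold IsAlternatingPair at h
    tauto
  edge_vert := fun _ => Set.mem_univ _
  symm := ⟨by
    rintro ⟨v, i⟩ ⟨w, j⟩ ⟨rfl, h⟩
    exact ⟨rfl, h.symm⟩⟩

lemma alternatingMatching_isPerfectMatching {V : Type*} (G : SimpleGraph V) (X : Set V) (k : ℕ)
    (hk : 2 ≤ k) : (alternatingMatching G X k hk).IsPerfectMatching := by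
  rw [Subgraph.isPerfectMatching_iff]
  rintro ⟨v, i, hi⟩
  have key : ∃ j, j < 2 * k ∧ IsAlternatingPair X (2 * k) v i j := by
    unfold IsAlternatingPair
    by_cases hv : v ∈ X <;> rcases Nat.mod_two_eq_zero_or_one i with h | h
    · exact ⟨i + 1, by omega, by simp [hv, h]⟩
    · exact ⟨i - 1, by omega, Or.inr (Or.inl ⟨by omega, by simp only [hv, true_iff]; omega⟩)⟩
    · by_cases h0 : i = 0
      · exact ⟨2 * k - 1, by omega, Or.inr (Or.inr ⟨hv, by omega⟩)⟩
      · exact ⟨i - 1, by omega, Or.inr (Or.inl ⟨by omega, by simp only [hv, false_iff]; omega⟩)⟩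
    · by_cases h0 : i = 2 * k - 1
      · exact ⟨0, by omega, Or.inr (Or.inr ⟨hv, by omega⟩)⟩
      · exact ⟨i + 1, by omega, by simp [hv, h]⟩
  obtain ⟨j, hj, hij⟩ := key
  refine ⟨(v, ⟨j, hj⟩), ⟨rfl, hij⟩, ?_⟩
  rintro ⟨w, l, hl⟩ ⟨rfl, hil⟩
  simp only [Prod.mk.injEq, Fin.mk.injEq, true_and]
  unfold IsAlternatingPair at hij hil
  simp only at hil
  by_cases hv : v ∈ X <;> simp only [hv, true_iff, false_iff, not_true, not_false_eq_true,
    true_and, false_and, or_false] at hij hil <;> omega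

lemma adj_succ_of_isPerfectMatching {V : Type*} {G : SimpleGraph V} {X : Set V}
    (hbip : ∀ u v, G.Adj u v → (u ∈ X ↔ v ∉ X)) {k : ℕ} (hk : 2 ≤ k)
    {M : (G □ cycleGraph (2 * k)).Subgraph} (hM : M.IsPerfectMatching)
    (h₀ : 0 < 2 * k) (h₁ : 1 < 2 * k) (h₂ : 2 * k - 1 < 2 * k)
    (hX : ∀ x ∈ X, M.Adj (x, ⟨0, h₀⟩) (x, ⟨1, h₁⟩))
    (hY : ∀ y ∉ X, M.Adj (y, ⟨0, h₀⟩) (y, ⟨2 * k - 1, h₂⟩))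
    (n : ℕ) (hn : n + 1 < 2 * k) (v : V) (hv : v ∈ X ↔ n % 2 = 0) :
    M.Adj (v, ⟨n, by omega⟩) (v, ⟨n + 1, hn⟩) := by
  induction n using Nat.strong_induction_on generalizing v with
  | _ n ih =>
  obtain _ | n := n
  · exact hX v (hv.2 rfl)
  obtain ⟨⟨w, j, hj⟩, hb, -⟩ := Subgraph.isPerfectMatching_iff.1 hM (v, ⟨n + 1, by omega⟩)
  rcases boxProd_adj.1 hb.adj_sub with ⟨hvw, h⟩ | ⟨h, hvw⟩
  · obtain rfl : n + 1 = j := congrArg Fin.val h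
    have hw := ih n (by omega) (by omega) w (by
      have := hbip v w hvw
      by_cases w ∈ X <;> simp_all <;> omega)
    have := hM.1.eq_of_adj_right hw hb
    simp at this
  · obtain rfl : v = w := hvw
    rw [cycleGraph_adj_iff_val (by omega)] at h
    simp only at h
    by_cases hjn : j = n
    · subst hjn
      obtain _ | m := j
      · have := hM.1.eq_of_adj_left hb.symm (hY v (by rw [hv]; simp))
        simp only [Prod.mk.injEq, Fin.mk.injEq, true_and] at this
        omega
      · have := hM.1.eq_of_adj_left hb.symm (ih m (by omega) (by omega) v (by rw [hv]; omega)).symm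
        simp only [Prod.mk.injEq, Fin.mk.injEq, true_and] at this
        omega
    · obtain rfl : j = n + 1 + 1 := by omega
      exact hb

lemma alternatingMatching_unique {V : Type*} {G : SimpleGraph V} {X : Set V}
    (hbip : ∀ u v, G.Adj u v → (u ∈ X ↔ v ∉ X)) {k : ℕ} (hk : 2 ≤ k)
    {M : (G □ cycleGraph (2 * k)).Subgraph} (hM : M.IsPerfectMatching)
    (h₀ : 0 < 2 * k) (h₁ : 1 < 2 * k) (h₂ : 2 * k - 1 < 2 * k)
    (hX : ∀ x ∈ X, M.Adj (x, ⟨0, h₀⟩) (x, ⟨1, h₁⟩))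
    (hY : ∀ y ∉ X, M.Adj (y, ⟨0, h₀⟩) (y, ⟨2 * k - 1, h₂⟩)) :
    M = alternatingMatching G X k hk := by
  have hle : ∀ a b, (alternatingMatching G X k hk).Adj a b → M.Adj a b := by
    rintro ⟨v, i, hi⟩ ⟨w, j, hj⟩ ⟨rfl, h⟩
    rcases h with ⟨h, hv⟩ | ⟨h, hv⟩ | ⟨hv, ⟨h, h'⟩ | ⟨h, h'⟩⟩
    · obtain rfl : j = i + 1 := h
      exact adj_succ_of_isPerfectMatching hbip hk hM h₀ h₁ h₂ hX hY i hj v hv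
    · obtain rfl : i = j + 1 := h
      exact (adj_succ_of_isPerfectMatching hbip hk hM h₀ h₁ h₂ hX hY j hi v hv).symm
    · obtain rfl : i = 0 := h
      obtain rfl : j = 2 * k - 1 := h'
      exact hY v hv
    · obtain rfl : j = 0 := h
      obtain rfl : i = 2 * k - 1 := h'
      exact (hY v hv).symm
  refine Subgraph.ext (Subgraph.isSpanning_iff.1 hM.2) ?_
  ext a b
  refine ⟨fun h => ?_, hle a b⟩
  obtain ⟨c, hc, -⟩ :=
    Subgraph.isPerfectMatching_iff.1 (alternatingMatching_isPerfectMatching G X k hk) a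
  rwa [hM.1.eq_of_adj_left h (hle a c hc)]

theorem stmt6 {V : Type*} [Fintype V] (G : SimpleGraph V)
    (X : Set V) (hbip : ∀ u v, G.Adj u v → (u ∈ X ↔ v ∉ X))
    (k : ℕ) (hk : 2 ≤ k) :
    (∃! M : (G □ cycleGraph (2 * k)).Subgraph, M.IsPerfectMatching ∧
        ({e | ∃ x ∈ X, e = s((x, (⟨0, by omega⟩ : Fin (2 * k))), (x, ⟨1, by omega⟩))} ∪
         {e | ∃ y ∈ Xᶜ, e = s((y, (⟨0, by omega⟩ : Fin (2 * k))), (y, ⟨2 * k - 1, by omega⟩))})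
          ⊆ M.edgeSet) ∧
    minForcingNumber (G □ cycleGraph (2 * k)) ≤ Fintype.card V := by
  classical
  let S : Set (Sym2 (V × Fin (2 * k))) :=
    {e | ∃ x ∈ X, e = s((x, (⟨0, by omega⟩ : Fin (2 * k))), (x, ⟨1, by omega⟩))} ∪
      {e | ∃ y ∈ Xᶜ, e = s((y, (⟨0, by omega⟩ : Fin (2 * k))), (y, ⟨2 * k - 1, by omega⟩))}
  have hperf := alternatingMatching_isPerfectMatching G X k hk
  have hsub : S ⊆ (alternatingMatching G X k hk).edgeSet := by
    rintro e (⟨x, hx, rfl⟩ | ⟨y, hy, rfl⟩)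
    · exact ⟨rfl, Or.inl ⟨rfl, by simpa using hx⟩⟩
    · exact ⟨rfl, Or.inr (Or.inr ⟨hy, Or.inl ⟨rfl, rfl⟩⟩)⟩
  have huniq : ∀ M : (G □ cycleGraph (2 * k)).Subgraph, M.IsPerfectMatching → S ⊆ M.edgeSet →
      M = alternatingMatching G X k hk := fun M hM hSM =>
    alternatingMatching_unique hbip hk hM _ _ _ (fun x hx => hSM (Or.inl ⟨x, hx, rfl⟩))
      (fun y hy => hSM (Or.inr ⟨y, hy, rfl⟩))
  have hcard : S.ncard ≤ Fintype.card V := by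
    have hrange : S ⊆ (fun v : V => s((v, (⟨0, by omega⟩ : Fin (2 * k))),
        (v, if v ∈ X then (⟨1, by omega⟩ : Fin (2 * k)) else ⟨2 * k - 1, by omega⟩))) ''
          Set.univ := by
      rintro e (⟨x, hx, rfl⟩ | ⟨y, hy, rfl⟩)
      · exact ⟨x, trivial, by simp [hx]⟩
      · exact ⟨y, trivial, by simp [show y ∉ X from hy]⟩
    calc S.ncard ≤ _ := Set.ncard_le_ncard hrange (Set.toFinite _)
      _ ≤ (Set.univ : Set V).ncard := Set.ncard_image_le (Set.toFinite _)
      _ = Fintype.card V := by rw [Set.ncard_univ, Nat.card_eq_fintype_card]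
  refine ⟨⟨_, ⟨hperf, hsub⟩, fun M hM => huniq M hM.1 hM.2⟩, ?_⟩
  calc minForcingNumber (G □ cycleGraph (2 * k))
      ≤ forcingNumber _ (alternatingMatching G X k hk) := Nat.sInf_le ⟨_, hperf, rfl⟩
    _ ≤ S.ncard := Nat.sInf_le ⟨S, hsub, rfl, huniq⟩
    _ ≤ Fintype.card V := hcard
end

section
/- Let F be a field, let m ≥ 1, and let B be an invertible m × m matrix over F. Then the 4m × 4m block matrix R with block rows (B, I, 0, 2I), (I, −B⁻¹, 2I, 0), (0, I, −B, I), (I, 0, I, B⁻¹) (each block of size m × m, I the m × m identity) has rank(R) ≤ 2m. -/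
/-- A block matrix whose blocks factor through `n` intermediate block indices has rank at most
`n * m`. -/
theorem Matrix.rank_of_blocks_le {F : Type*} [Field F] {m n k l : ℕ}
    (R : Fin k → Fin l → Matrix (Fin m) (Fin m) F)
    (P : Fin k → Fin n → Matrix (Fin m) (Fin m) F)
    (Q : Fin n → Fin l → Matrix (Fin m) (Fin m) F)
    (h : ∀ a b, R a b = ∑ c, P a c * Q c b) :
    (Matrix.of (fun (p : Fin k × Fin m) (q : Fin l × Fin m) => R p.1 q.1 p.2 q.2)).rank
      ≤ n * m := by
  have hmul : Matrix.of (fun (p : Fin k × Fin m) (q : Fin l × Fin m) => R p.1 q.1 p.2 q.2) =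
      Matrix.of (fun (p : Fin k × Fin m) (q : Fin n × Fin m) => P p.1 q.1 p.2 q.2) *
      Matrix.of (fun (p : Fin n × Fin m) (q : Fin l × Fin m) => Q p.1 q.1 p.2 q.2) := by
    ext p q
    simp [h, Matrix.mul_apply, Matrix.sum_apply, Fintype.sum_prod_type]
  rw [hmul]
  refine (Matrix.rank_mul_le_left _ _).trans ((Matrix.rank_le_card_width _).trans ?_)
  simp

theorem stmt7 {F : Type*} [Field F] (m : ℕ) (hm : 1 ≤ m)
    (B : Matrix (Fin m) (Fin m) F) (hB : IsUnit B.det) :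
    (Matrix.of (fun (p q : Fin 4 × Fin m) =>
      (![![B, 1, 0, 2],
         ![1, -B⁻¹, 2, 0],
         ![0, 1, -B, 1],
         ![1, 0, 1, B⁻¹]] : Fin 4 → Fin 4 → Matrix (Fin m) (Fin m) F) p.1 q.1 p.2 q.2)).rank
      ≤ 2 * m := by
  -- The first two block rows are combinations of the last two.
  refine Matrix.rank_of_blocks_le _ ![![1, B], ![-B⁻¹, 1], ![1, 0], ![0, 1]]
    ![![0, 1, -B, 1], ![1, 0, 1, B⁻¹]] fun a b => ?_
  fin_cases a <;> fin_cases b <;>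
    simp [Fin.sum_univ_two, Matrix.mul_nonsing_inv B hB, Matrix.nonsing_inv_mul B hB,
      one_add_one_eq_two]
end

section
/- Let F be a field, let m ≥ 1, let k ≥ 3 be an integer divisible by 3, and let B be an invertible m × m matrix over F. Define the 2km × 2km matrix R as a 2k × 2k block matrix with m × m blocks R_{ij} (indices taken modulo 2k) given by: R_{ii} = B if i is odd and R_{ii} = B⁻¹ if i is even; R_{i-1,i} = R_{i+1,i} = I for all i (so in particular R_{1,2k} = R_{2k,1} = I); and all other blocks zero. Then rank(R) ≤ (2k − 2)m. -/
section AlternatingRecurrence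

variable {F V : Type*} [Field F] [AddCommGroup V] [Module F V]

/-- The solution of `v (n + 2) + S (n + 1) (v (n + 1)) + v n = 0`, where `S` is `f` at even and
`g` at odd indices, as a linear function of its initial values `(v 0, v 1)`. -/
def alternatingSolution (f g : V →ₗ[F] V) : ℕ → V × V →ₗ[F] V
  | 0 => LinearMap.fst F V V
  | 1 => LinearMap.snd F V V
  | n + 2 => -((if Even (n + 1) then f else g) ∘ₗ alternatingSolution f g (n + 1)) -
      alternatingSolution f g n

theorem alternatingSolution_add_two (f g : V →ₗ[F] V) (n : ℕ) (x : V × V) :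
    alternatingSolution f g (n + 2) x =
      -(if Even (n + 1) then f else g) (alternatingSolution f g (n + 1) x) -
        alternatingSolution f g n x := by
  rw [alternatingSolution]
  rfl

theorem alternatingSolution_periodic {f g : V →ₗ[F] V} (hfg : ∀ v, f (g v) = v)
    (hgf : ∀ v, g (f v) = v) (x : V × V) :
    Function.Periodic (fun n => alternatingSolution f g n x) 6 := by
  intro n
  rcases Nat.even_or_odd n with hn | hn
  · have h1 : ¬ Even (n + 1) := by grind
    have h3 : ¬ Even (n + 3) := by grind
    have h5 : ¬ Even (n + 5) := by grind
    have h2 : Even (n + 2) := by grind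
    have h4 : Even (n + 4) := by grind
    simp [alternatingSolution_add_two, hfg, hgf, h1, h2, h3, h4, h5]
    abel
  · have h1 : Even (n + 1) := by grind
    have h3 : Even (n + 3) := by grind
    have h5 : Even (n + 5) := by grind
    have h2 : ¬ Even (n + 2) := by grind
    have h4 : ¬ Even (n + 4) := by grind
    simp [alternatingSolution_add_two, hfg, hgf, h1, h2, h3, h4, h5]
    abel

end AlternatingRecurrence

/-- Multiplying a block cyclic tridiagonal matrix with identity off-diagonal blocks by a vector. -/
theorem blockCyclic_mulVec {F : Type*} [Field F] {m n : ℕ} (hn : 3 ≤ n)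
    (D : ℕ → Matrix (Fin m) (Fin m) F) (v : ℕ → Fin m → F) (i : Fin n) (r : Fin m) :
    ((Matrix.of (fun (p q : Fin n × Fin m) =>
      (if p.1 = q.1 then D p.1
       else if (q.1 : ℕ) = ((p.1 : ℕ) + 1) % n ∨ (p.1 : ℕ) = ((q.1 : ℕ) + 1) % n
         then (1 : Matrix (Fin m) (Fin m) F) else 0) p.2 q.2)).mulVec
        (fun q => v q.1 q.2)) (i, r) =
      (D i).mulVec (v i) r + v ((i + 1) % n) r + v ((i + n - 1) % n) r := by
  have hi := i.isLt
  let s : Fin n := ⟨(i + 1) % n, Nat.mod_lt _ (by omega)⟩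
  let t : Fin n := ⟨(i + n - 1) % n, Nat.mod_lt _ (by omega)⟩
  have mod_cases (a : ℕ) (ha : a < 2 * n) : a % n = if a < n then a else a - n := by
    split_ifs with h
    · exact Nat.mod_eq_of_lt h
    · rw [Nat.mod_eq_sub_mod (by omega), Nat.mod_eq_of_lt (by omega)]
  have block (j : Fin n) :
      (∑ c, (if i = j then D i
        else if (j : ℕ) = ((i : ℕ) + 1) % n ∨ (i : ℕ) = ((j : ℕ) + 1) % n
          then (1 : Matrix (Fin m) (Fin m) F) else 0) r c * v j c) =
      (if j = i then (D i).mulVec (v j) r else 0) + (if j = s then v j r else 0) +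
        (if j = t then v j r else 0) := by
    have hj := j.isLt
    change (Matrix.mulVec _ (v j)) r = _
    have hs : j = s ↔ (j : ℕ) = (i + 1) % n := by simp [s, Fin.ext_iff]
    have ht : j = t ↔ (i : ℕ) = (j + 1) % n := by
      simp only [t, Fin.ext_iff]
      rw [mod_cases _ (by omega), mod_cases _ (by omega)]
      split_ifs <;> omega
    have his : i ≠ s := by
      simp only [s, ne_eq, Fin.ext_iff]
      rw [mod_cases _ (by omega)]
      split_ifs <;> omega
    have hit : i ≠ t := by
      simp only [t, ne_eq, Fin.ext_iff]
      rw [mod_cases _ (by omega)]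
      split_ifs <;> omega
    have hst : s ≠ t := by
      simp only [s, t, ne_eq, Fin.ext_iff]
      rw [mod_cases _ (by omega), mod_cases _ (by omega)]
      split_ifs <;> omega
    simp only [← hs, ← ht]
    by_cases h1 : j = i
    · subst h1
      simp [his, hit]
    · by_cases h2 : j = s
      · simp [h2, his, his.symm, hst]
      · by_cases h3 : j = t
        · simp [h3, hit, hit.symm, hst.symm]
        · simp [h1, h2, h3, Ne.symm h1]
  simp only [Matrix.mulVec, dotProduct, Matrix.of_apply, Fintype.sum_prod_type]
  rw [Finset.sum_congr rfl fun j _ => block j]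
  simp [Finset.sum_add_distrib, s, t, Matrix.mulVec, dotProduct]

theorem stmt8 {F : Type*} [Field F] (m k : ℕ) (hm : 1 ≤ m) (hk : 3 ≤ k) (hdvd : 3 ∣ k)
    (B : Matrix (Fin m) (Fin m) F) (hB : IsUnit B.det) :
    (Matrix.of (fun (p q : Fin (2 * k) × Fin m) =>
      (if p.1 = q.1 then (if Even (p.1 : ℕ) then B else B⁻¹)
       else if (q.1 : ℕ) = ((p.1 : ℕ) + 1) % (2 * k) ∨ (p.1 : ℕ) = ((q.1 : ℕ) + 1) % (2 * k)
         then (1 : Matrix (Fin m) (Fin m) F) else 0) p.2 q.2)).rank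
      ≤ (2 * k - 2) * m := by
  let u := alternatingSolution B.mulVecLin B⁻¹.mulVecLin
  have hper (x) : Function.Periodic (fun n => u n x) (2 * k) := by
    obtain ⟨c, rfl⟩ := hdvd
    rw [show 2 * (3 * c) = c * 6 by ring]
    exact (alternatingSolution_periodic (f := B.mulVecLin) (g := B⁻¹.mulVecLin)
      (by simp [Matrix.mul_nonsing_inv _ hB]) (by simp [Matrix.nonsing_inv_mul _ hB]) x).nat_mul c
  let φ : (Fin m → F) × (Fin m → F) →ₗ[F] (Fin (2 * k) × Fin m → F) :=
    LinearMap.pi fun q => LinearMap.proj q.2 ∘ₗ u q.1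
  have hφ : Function.Injective φ := by
    intro x y h
    ext r
    · exact congrFun h (⟨0, by omega⟩, r)
    · exact congrFun h (⟨1, by omega⟩, r)
  set R := Matrix.of (fun (p q : Fin (2 * k) × Fin m) =>
      (if p.1 = q.1 then (if Even (p.1 : ℕ) then B else B⁻¹)
       else if (q.1 : ℕ) = ((p.1 : ℕ) + 1) % (2 * k) ∨ (p.1 : ℕ) = ((q.1 : ℕ) + 1) % (2 * k)
         then (1 : Matrix (Fin m) (Fin m) F) else 0) p.2 q.2)
  have hker : LinearMap.range φ ≤ LinearMap.ker R.mulVecLin := by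
    rintro _ ⟨x, rfl⟩
    rw [LinearMap.mem_ker]
    ext ⟨i, r⟩
    have key := blockCyclic_mulVec (n := 2 * k) (by omega)
      (fun i => if Even i then B else B⁻¹) (fun n => u n x) i r
    have hrec := alternatingSolution_add_two B.mulVecLin B⁻¹.mulVecLin (i + 2 * k - 1) x
    rw [show (i : ℕ) + 2 * k - 1 + 2 = i + 1 + 2 * k by omega,
      show (i : ℕ) + 2 * k - 1 + 1 = i + 2 * k by omega] at hrec
    have h1 := hper x (i + 1)
    have h0 := hper x i
    have e1 := (hper x).map_mod_nat (i + 1)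
    have e2 := (hper x).map_mod_nat (i + 2 * k - 1)
    simp only [u] at h0 h1 e1 e2
    rw [h1, h0] at hrec
    have hpar : Even ((i : ℕ) + 2 * k) ↔ Even (i : ℕ) := by simp [Nat.even_add]
    refine key.trans ?_
    simp only [u, e1, e2, hrec, hpar]
    split_ifs <;> simp <;> abel
  have hdim := LinearMap.finrank_range_add_finrank_ker R.mulVecLin
  have hle := Submodule.finrank_mono hker
  rw [LinearMap.finrank_range_of_inj hφ] at hle
  simp only [Module.finrank_prod, Module.finrank_fintype_fun_eq_card, Fintype.card_prod,
    Fintype.card_fin] at hdim hle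
  rw [Matrix.rank, Nat.sub_mul]
  omega
end

section
/- Let F be a field with |F| ≥ 4 and let G be a finite simple bipartite graph that admits an involutory weighted adjacency matrix over F. Then for every positive integer d and every integer k ≥ 2, f(G □ Q_d □ C_{2k}) = 2^d·|V(G)|. -/
open SimpleGraph

/-- The perfect matching whose edges are the orbits of an adjacency-respecting involution. -/
def matchingOfInvolution {U : Type*} {X : SimpleGraph U} (m : U → U) (hm : ∀ u, m (m u) = u)
    (hadj : ∀ u, X.Adj u (m u)) : X.Subgraph where
  verts := Set.univ
  Adj u v := v = m u
  adj_sub := by rintro u _ rfl; exact hadj u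
  edge_vert _ := Set.mem_univ _
  symm := ⟨by rintro u _ rfl; exact (hm u).symm⟩

theorem matchingOfInvolution_isPerfectMatching {U : Type*} {X : SimpleGraph U} (m : U → U)
    (hm : ∀ u, m (m u) = u) (hadj : ∀ u, X.Adj u (m u)) :
    (matchingOfInvolution m hm hadj).IsPerfectMatching :=
  Subgraph.isPerfectMatching_iff.2 fun u => ⟨m u, rfl, fun _ h => h⟩

theorem exists_involution_of_isPerfectMatching {U : Type*} {X : SimpleGraph U} {M : X.Subgraph}
    (hM : M.IsPerfectMatching) :
    ∃ m : U → U, (∀ u, m (m u) = u) ∧ ∀ u v, M.Adj u v ↔ v = m u := by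
  choose m hm hu using Subgraph.isPerfectMatching_iff.1 hM
  exact ⟨m, fun u => (hu _ _ (hm u).symm).symm, fun u v => ⟨hu u v, fun h => h ▸ hm u⟩⟩

theorem IsPerfectMatching.eq_of_adj_imp {U : Type*} {X : SimpleGraph U} {M M' : X.Subgraph}
    (hM : M.IsPerfectMatching) (hM' : M'.IsPerfectMatching)
    (h : ∀ u v, M.Adj u v → M'.Adj u v) : M' = M := by
  obtain ⟨m, -, hm⟩ := exists_involution_of_isPerfectMatching hM
  obtain ⟨m', -, hm'⟩ := exists_involution_of_isPerfectMatching hM'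
  have hmm : m' = m := funext fun u => ((hm' _ _).1 (h u (m u) ((hm _ _).2 rfl))).symm
  refine Subgraph.ext ?_ ?_
  · rw [Set.eq_univ_of_forall hM.2, Set.eq_univ_of_forall hM'.2]
  · ext u v
    rw [hm, hm', hmm]

/-- A self-map of a finite type agrees with some permutation on the non-fixed points of that
permutation and at some point of a given nonempty invariant set. -/
theorem exists_perm_eq_or_eq_self_s10 {U : Type*} [Finite U] (φ : U → U) (T : Set U) (hT : T.Nonempty)
    (hφ : Set.MapsTo φ T T) :
    ∃ e : Equiv.Perm U, (∀ u, e u = φ u ∨ e u = u) ∧ ∃ v ∈ T, e v = φ v := by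
  classical
  have hbij := Function.bijOn_periodicPts φ
  have hsub (u : U) (hu : u ∈ Function.periodicPts φ) :
      Equiv.Perm.ofSubtype (p := (· ∈ Function.periodicPts φ)) (hbij.equiv φ) u = φ u := by
    rw [Equiv.Perm.ofSubtype_apply_of_mem _ hu]
    rfl
  refine ⟨Equiv.Perm.ofSubtype (p := (· ∈ Function.periodicPts φ)) (hbij.equiv φ), ?_, ?_⟩
  · intro u
    by_cases hu : u ∈ Function.periodicPts φ
    · exact Or.inl (hsub u hu)
    · exact Or.inr (Equiv.Perm.ofSubtype_apply_of_not_mem _ hu)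
  · obtain ⟨v, hv⟩ := hT
    have hit (n : ℕ) : φ^[n] v ∈ T := hφ.iterate n hv
    obtain ⟨a, b, hab, h⟩ := Finite.exists_ne_map_eq_of_infinite fun n : ℕ => φ^[n] v
    wlog hlt : a < b generalizing a b
    · exact this b a hab.symm h.symm (by omega)
    refine ⟨φ^[a] v, hit a, hsub _ ⟨b - a, by omega, ?_⟩⟩
    change φ^[b - a] (φ^[a] v) = φ^[a] v
    rw [← Function.iterate_add_apply, Nat.sub_add_cancel hlt.le]
    exact h.symm

/-- A kernel vector of a weighted adjacency matrix of a bipartite graph is zero if it vanishes on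
all vertices covered by a forcing set of a perfect matching. -/
theorem eq_zero_of_forcing {U F : Type*} [Fintype U] [Field F] {X : SimpleGraph U}
    (c : U → Bool) (hc : ∀ u v, X.Adj u v → c u ≠ c v)
    (W : Matrix U U F) (hW : ∀ u v, W u v ≠ 0 ↔ X.Adj u v)
    {M : X.Subgraph} (hM : M.IsPerfectMatching) {S : Set (Sym2 U)} (hS : S ⊆ M.edgeSet)
    (hforce : ∀ M' : X.Subgraph, M'.IsPerfectMatching → S ⊆ M'.edgeSet → M' = M)
    (x : U → F) (hx : ∀ u, ∑ v, W u v * x v = 0)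
    (hxS : ∀ e ∈ S, ∀ v ∈ e, x v = 0) : x = 0 := by
  classical
  obtain ⟨m, hmm, hm⟩ := exists_involution_of_isPerfectMatching hM
  have hmadj (u : U) : X.Adj u (m u) := M.adj_sub ((hm _ _).2 rfl)
  by_contra hx0
  obtain ⟨v₀, hv₀⟩ := Function.ne_iff.1 hx0
  set b := c v₀
  have hcm (u : U) (h : c u = b) : c (m u) ≠ b := h ▸ (hc _ _ (hmadj u)).symm
  have hcm' (u : U) (h : c u ≠ b) : c (m u) = b := by
    have := hc _ _ (hmadj u)
    revert this h
    cases c u <;> cases c (m u) <;> cases b <;> simp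
  have hstep (v : U) (hv : x v ≠ 0) : ∃ w, X.Adj (m v) w ∧ w ≠ v ∧ x w ≠ 0 := by
    by_contra! hcon
    have h := hx (m v)
    rw [Finset.sum_eq_single v] at h
    · exact mul_ne_zero ((hW _ _).2 (hmadj v).symm) hv h
    · intro w _ hw
      by_cases hadj : X.Adj (m v) w
      · rw [hcon w hadj hw, mul_zero]
      · rw [not_not.1 (mt (hW _ _).1 hadj), zero_mul]
    · simp
  choose ψ hψ using hstep
  let φ : U → U := fun v => if h : x v ≠ 0 ∧ c v = b then ψ v h.1 else v
  let T : Set U := {v | x v ≠ 0 ∧ c v = b}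
  have hφT (v : U) (hv : v ∈ T) : φ v = ψ v hv.1 := dif_pos hv
  have hφT' (v : U) (hv : v ∉ T) : φ v = v := dif_neg hv
  have hφadj (v : U) : X.Adj (m v) (φ v) := by
    by_cases hv : v ∈ T
    · rw [hφT v hv]; exact (hψ v hv.1).1
    · rw [hφT' v hv]; exact (hmadj v).symm
  have hφc (v : U) : c (φ v) = c v := by
    have h1 := hc _ _ (hφadj v)
    have h2 := hc _ _ (hmadj v)
    revert h1 h2
    cases c v <;> cases c (m v) <;> cases c (φ v) <;> simp
  obtain ⟨e, he, v, hvT, hev⟩ := exists_perm_eq_or_eq_self_s10 φ T ⟨v₀, hv₀, rfl⟩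
    (fun v hv => ⟨by rw [hφT v hv]; exact (hψ v hv.1).2.2, by rw [hφc]; exact hv.2⟩)
  have hec (u : U) : c (e u) = c u := by
    rcases he u with h | h <;> rw [h]
    exact hφc u
  have hec' (u : U) : c (e.symm u) = c u := by rw [← hec, e.apply_symm_apply]
  have headj (u : U) : X.Adj (m u) (e u) := by
    rcases he u with h | h <;> rw [h]
    · exact hφadj u
    · exact (hmadj u).symm
  have hfix (u : U) (hu : u ∉ T) : e u = u := by
    rcases he u with h | h
    · rw [h, hφT' u hu]
    · exact h
  let m' : U → U := fun u => if c u = b then m (e.symm u) else e (m u)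
  have h_side (u : U) (h : c u = b) : m' u = m (e.symm u) := if_pos h
  have h_other (u : U) (h : c u ≠ b) : m' u = e (m u) := if_neg h
  have hinvol (u : U) : m' (m' u) = u := by
    by_cases h : c u = b
    · rw [h_side u h, h_other _ (hcm _ ((hec' u).trans h)), hmm, e.apply_symm_apply]
    · rw [h_other u h, h_side _ ((hec _).trans (hcm' u h)), e.symm_apply_apply, hmm]
  have h_new_adj (u : U) : X.Adj u (m' u) := by
    by_cases h : c u = b
    · have := headj (e.symm u)
      rw [e.apply_symm_apply] at this
      rw [h_side u h]
      exact this.symm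
    · have := headj (m u)
      rw [hmm] at this
      rwa [h_other u h]
  have hmem (u : U) (hcu : c u = b) (hu : x u = 0) : m' u = m u := by
    have hfu : e u = u := hfix u fun h => h.1 hu
    rw [h_side u hcu, e.symm_apply_eq.2 hfu.symm]
  have heq := hforce _ (matchingOfInvolution_isPerfectMatching m' hinvol h_new_adj) (by
    intro s hs
    have hsM := hS hs
    have hsx := hxS s hs
    induction s with
    | _ p q =>
      have hq : q = m p := (hm _ _).1 hsM
      subst hq
      change m p = m' p
      by_cases h : c p = b
      · exact (hmem p h (hsx p (by simp))).symm
      · have := hmem (m p) (hcm' p h) (hsx _ (by simp))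
        rw [hmm] at this
        rw [← hinvol (m p), this])
  have h1 : M.Adj (m v) (m' (m v)) := by
    rw [← heq]
    rfl
  rw [hm, hmm, h_other _ (hcm v hvT.2), hmm, hev, hφT v hvT] at h1
  exact (hψ v hvT.1).2.1 h1

theorem le_minForcingNumber {U F P : Type*} [Fintype U] [Field F] [AddCommGroup P] [Module F P]
    [FiniteDimensional F P] {X : SimpleGraph U} (c : U → Bool)
    (hc : ∀ u v, X.Adj u v → c u ≠ c v)
    (W : Matrix U U F) (hW : ∀ u v, W u v ≠ 0 ↔ X.Adj u v)
    (K : P →ₗ[F] (U → F)) (hK : Function.Injective K) (hker : ∀ p u, ∑ v, W u v * K p v = 0)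
    {h : ℕ} (hP : Module.finrank F P = 2 * h) (hex : ∃ M : X.Subgraph, M.IsPerfectMatching) :
    h ≤ minForcingNumber X := by
  classical
  obtain ⟨M₀, hM₀⟩ := hex
  refine le_csInf ⟨_, M₀, hM₀, rfl⟩ ?_
  rintro _ ⟨M, hM, rfl⟩
  refine le_csInf ⟨_, M.edgeSet, subset_rfl, rfl, fun M' hM' hsub =>
    IsPerfectMatching.eq_of_adj_imp hM hM' fun u v huv =>
      hsub (show s(u, v) ∈ M.edgeSet from huv)⟩ ?_
  rintro _ ⟨S, hS, rfl, hforce⟩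
  by_contra! hlt
  let L : P →ₗ[F] ((S → F) × (S → F)) :=
    LinearMap.prod (LinearMap.funLeft F F (fun e : S => e.1.out.1) ∘ₗ K)
      (LinearMap.funLeft F F (fun e : S => e.1.out.2) ∘ₗ K)
  have hL : L.ker ≠ ⊥ := by
    apply LinearMap.ker_ne_bot_of_finrank_lt
    rw [Module.finrank_prod, Module.finrank_fintype_fun_eq_card, hP, ← Nat.card_eq_fintype_card,
      Nat.card_coe_set_eq]
    omega
  obtain ⟨p, hp, hp0⟩ := Submodule.exists_mem_ne_zero_of_ne_bot hL
  refine hp0 (hK ?_)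
  rw [map_zero]
  refine eq_zero_of_forcing c hc W hW hM hS hforce (K p) (hker p) ?_
  intro e he v hv
  have hp' : L p = 0 := hp
  have h1 : K p e.out.1 = 0 := congrFun (congrArg Prod.fst hp') ⟨e, he⟩
  have h2 : K p e.out.2 = 0 := congrFun (congrArg Prod.snd hp') ⟨e, he⟩
  rw [← Quot.out_eq e] at hv
  rcases Sym2.mem_iff.1 hv with rfl | rfl
  · exact h1
  · exact h2

theorem hypercube_succ_adj {d : ℕ} (x y : Fin (d + 1) → Bool) :
    (hypercube (d + 1)).Adj x y ↔
      (x 0 = y 0 ∧ (hypercube d).Adj (Fin.tail x) (Fin.tail y)) ∨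
        (x 0 ≠ y 0 ∧ Fin.tail x = Fin.tail y) := by
  have key {n : ℕ} (u v : Fin n → Bool) :
      (hypercube n).Adj u v ↔ (Finset.univ.filter (fun i => u i ≠ v i)).card = 1 := by
    simp only [hypercube, SimpleGraph.fromRel_adj]
    constructor
    · rintro ⟨-, h | h⟩
      · exact h
      · simpa only [ne_comm] using h
    · refine fun h => ⟨?_, Or.inl h⟩
      rintro rfl
      simp at h
  rw [key, key, Fin.card_filter_univ_succ]
  by_cases h0 : x 0 = y 0
  · simp only [h0, Fin.tail]
    simp
    congr!
  · simp [h0, Fin.tail, funext_iff, Finset.filter_eq_empty_iff]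

theorem hypercube_bipartite (d : ℕ) :
    ∃ c : (Fin d → Bool) → Bool, ∀ u v, (hypercube d).Adj u v → c u ≠ c v := by
  induction d with
  | zero => exact ⟨fun _ => true, fun u v h => (h.ne (Subsingleton.elim u v)).elim⟩
  | succ d ih =>
    obtain ⟨c, hc⟩ := ih
    refine ⟨fun x => xor (x 0) (c (Fin.tail x)), fun x y hxy => ?_⟩
    rcases (hypercube_succ_adj x y).1 hxy with ⟨h0, ht⟩ | ⟨h0, ht⟩
    · have := hc _ _ ht
      simpa [h0] using this
    · simpa [ht] using h0

theorem boxProd_bipartite {α β : Type*} {G : SimpleGraph α} {H : SimpleGraph β}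
    (hG : ∃ c : α → Bool, ∀ u v, G.Adj u v → c u ≠ c v)
    (hH : ∃ c : β → Bool, ∀ u v, H.Adj u v → c u ≠ c v) :
    ∃ c : α × β → Bool, ∀ u v, (G □ H).Adj u v → c u ≠ c v := by
  obtain ⟨c, hc⟩ := hG
  obtain ⟨c', hc'⟩ := hH
  refine ⟨fun p => xor (c p.1) (c' p.2), fun p q hpq => ?_⟩
  rcases boxProd_adj.1 hpq with ⟨h, h'⟩ | ⟨h, h'⟩
  · simpa [h'] using hc _ _ h
  · simpa [h'] using hc' _ _ h

/-- Splitting off the first coordinate of the hypercube factor. -/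
def prodHypercubeSuccEquiv (V : Type*) (d : ℕ) :
    V × (Fin (d + 1) → Bool) ≃ (V × (Fin d → Bool)) ⊕ (V × (Fin d → Bool)) where
  toFun p := if p.2 0 then Sum.inr (p.1, Fin.tail p.2) else Sum.inl (p.1, Fin.tail p.2)
  invFun := Sum.elim (fun p => (p.1, Fin.cons false p.2)) (fun p => (p.1, Fin.cons true p.2))
  left_inv p := by
    obtain ⟨v, x⟩ := p
    cases h : x 0
    · simp only [h, Bool.false_eq_true, if_false, Sum.elim_inl]
      rw [← h, Fin.cons_self_tail]
    · simp only [h, if_true, Sum.elim_inr]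
      rw [← h, Fin.cons_self_tail]
  right_inv p := by
    rcases p with p | p <;> simp

/-- From a weighted adjacency matrix of `G □ Q_d` squaring to the identity, one for `G □ Q_{d+1}`
squaring to any given scalar `t ≠ a ^ 2`. -/
theorem exists_weighted_adj_succ {V F : Type*} [Fintype V] [DecidableEq V] [Field F]
    (G : SimpleGraph V) (d : ℕ) (B : Matrix (V × (Fin d → Bool)) (V × (Fin d → Bool)) F)
    (hB : ∀ p q, B p q ≠ 0 ↔ (G □ hypercube d).Adj p q) (hB1 : B * B = 1)
    (a t : F) (ha : a ≠ 0) (hat : a ^ 2 ≠ t) :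
    ∃ B' : Matrix (V × (Fin (d + 1) → Bool)) (V × (Fin (d + 1) → Bool)) F,
      (∀ p q, B' p q ≠ 0 ↔ (G □ hypercube (d + 1)).Adj p q) ∧ B' * B' = t • 1 := by
  refine ⟨(Matrix.fromBlocks (a • B) 1 ((t - a ^ 2) • 1) (-(a • B))).submatrix
    (prodHypercubeSuccEquiv V d) (prodHypercubeSuccEquiv V d), ?_, ?_⟩
  · rintro ⟨v, x⟩ ⟨w, y⟩
    have hB' := hB (v, Fin.tail x) (w, Fin.tail y)
    rw [boxProd_adj] at hB' ⊢
    simp only [hypercube_succ_adj] at hB' ⊢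
    have ht : t - a ^ 2 ≠ 0 := sub_ne_zero.2 hat.symm
    have hxy : x = y ↔ x 0 = y 0 ∧ Fin.tail x = Fin.tail y := by
      rw [← Fin.cons_self_tail x, ← Fin.cons_self_tail y, Fin.cons_inj]
      simp
    cases hx : x 0 <;> cases hy : y 0 <;>
      simp [prodHypercubeSuccEquiv, hx, hy, hxy, ha, ht, Matrix.one_apply, ← hB'] <;> tauto
  · rw [Matrix.submatrix_mul_equiv, Matrix.fromBlocks_multiply]
    have h : (a • B) * (a • B) = a ^ 2 •
        (1 : Matrix (V × (Fin d → Bool)) (V × (Fin d → Bool)) F) := by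
      rw [Matrix.smul_mul, Matrix.mul_smul, hB1, smul_smul, sq]
    have h' : (Matrix.fromBlocks (t • 1) 0 0 (t • 1) :
        Matrix ((V × (Fin d → Bool)) ⊕ (V × (Fin d → Bool)))
          ((V × (Fin d → Bool)) ⊕ (V × (Fin d → Bool))) F) = t • 1 := by
      rw [← Matrix.fromBlocks_one, Matrix.fromBlocks_smul, smul_zero]
    have hsq : Matrix.fromBlocks (a • B * a • B + 1 * (t - a ^ 2) • 1) (a • B * 1 + 1 * -(a • B))
        ((t - a ^ 2) • 1 * a • B + -(a • B) * (t - a ^ 2) • 1)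
        ((t - a ^ 2) • 1 * 1 + -(a • B) * -(a • B)) = t • 1 := by
      rw [← h', Matrix.fromBlocks_inj]
      refine ⟨?_, ?_, ?_, ?_⟩
      · rw [h, one_mul, ← add_smul, add_sub_cancel]
      · simp
      · simp [smul_smul, mul_comm]
      · rw [neg_mul_neg, h, mul_one, ← add_smul, sub_add_cancel]
    rw [hsq]
    ext p q
    simp [Matrix.one_apply]

theorem exists_weighted_adj_prod_hypercube {V F : Type*} [Fintype V] [DecidableEq V] [Field F]
    (G : SimpleGraph V) (A : Matrix V V F) (hA : ∀ u v, A u v ≠ 0 ↔ G.Adj u v) (hA1 : A * A = 1)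
    (a : F) (ha : a ≠ 0) (ha1 : a ^ 2 ≠ 1) (d : ℕ) :
    ∃ B : Matrix (V × (Fin d → Bool)) (V × (Fin d → Bool)) F,
      (∀ p q, B p q ≠ 0 ↔ (G □ hypercube d).Adj p q) ∧ B * B = 1 := by
  induction d with
  | zero =>
    let ε : V × (Fin 0 → Bool) ≃ V := Equiv.prodUnique V (Fin 0 → Bool)
    refine ⟨A.submatrix ε ε, fun p q => ?_, ?_⟩
    · have h2 : p.2 = q.2 := Subsingleton.elim _ _
      rw [boxProd_adj, Matrix.submatrix_apply, hA]
      simp [h2, ε]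
    · rw [Matrix.submatrix_mul_equiv, hA1, Matrix.submatrix_one_equiv]
  | succ d ih =>
    obtain ⟨B, hB, hB1⟩ := ih
    simpa only [one_smul] using exists_weighted_adj_succ G d B hB hB1 a 1 ha ha1

theorem exists_ne_zero_sq_ne_one {F : Type*} [Field F] (hF : 4 ≤ Cardinal.mk F) :
    ∃ a : F, a ≠ 0 ∧ a ^ 2 ≠ 1 := by
  classical
  by_contra! h
  have hs : (({0, 1, -1} : Finset F) : Set F) = Set.univ := by
    refine Set.eq_univ_of_forall fun a => ?_
    by_cases ha : a = 0
    · simp [ha]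
    · rcases eq_or_eq_neg_of_sq_eq_sq a 1 (by simpa using h a ha) with h | h <;> simp [h]
  have h3 : Cardinal.mk F ≤ 3 := by
    rw [← Cardinal.mk_univ, ← hs, Finset.coe_sort_coe, Cardinal.mk_coe_finset]
    exact_mod_cast Finset.card_le_three
  have : (4 : Cardinal) ≤ 3 := hF.trans h3
  norm_num at this

/-- The cyclic successor on `Fin n`. -/
def cycSucc {n : ℕ} (i : Fin n) : Fin n := ⟨(i + 1) % n, Nat.mod_lt _ i.pos⟩

/-- The cyclic predecessor on `Fin n`. -/
def cycPred {n : ℕ} (i : Fin n) : Fin n := ⟨(i + n - 1) % n, Nat.mod_lt _ i.pos⟩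

theorem val_cycSucc {n : ℕ} (i : Fin n) :
    (cycSucc i : ℕ) = if (i : ℕ) + 1 = n then 0 else (i : ℕ) + 1 := by
  have := i.2
  split_ifs with h
  · simp [cycSucc, h]
  · exact Nat.mod_eq_of_lt (by omega)

theorem val_cycPred {n : ℕ} (i : Fin n) :
    (cycPred i : ℕ) = if (i : ℕ) = 0 then n - 1 else (i : ℕ) - 1 := by
  have := i.2
  split_ifs with h
  · simp only [cycPred, h, zero_add]
    exact Nat.mod_eq_of_lt (by omega)
  · have : (i : ℕ) + n - 1 = (i - 1) + n := by omega
    simp only [cycPred, this, Nat.add_mod_right]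
    exact Nat.mod_eq_of_lt (by omega)

theorem cycPred_cycSucc {n : ℕ} (i : Fin n) : cycPred (cycSucc i) = i := by
  have := i.2
  apply Fin.ext
  have h1 := val_cycSucc i
  have h2 := val_cycPred (cycSucc i)
  split_ifs at h1 h2 <;> omega

theorem cycSucc_cycPred {n : ℕ} (i : Fin n) : cycSucc (cycPred i) = i := by
  have := i.2
  apply Fin.ext
  have h1 := val_cycPred i
  have h2 := val_cycSucc (cycPred i)
  split_ifs at h1 h2 <;> omega

theorem cycleGraph_adj_iff {n : ℕ} (hn : 2 ≤ n) (i j : Fin n) :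
    (cycleGraph n).Adj i j ↔ j = cycSucc i ∨ j = cycPred i := by
  have hi := i.2
  have hj := j.2
  have key (a b : Fin n) : ((a - b : Fin n) : ℕ) = if (b : ℕ) ≤ a then (a : ℕ) - b else n + a - b := by
    have ha := a.2
    have hb := b.2
    rw [Fin.sub_def]
    split_ifs with h
    · have : n - (b : ℕ) + a = (a - b) + n := by omega
      simp only [this, Nat.add_mod_right]
      exact Nat.mod_eq_of_lt (by omega)
    · have : n - (b : ℕ) + a = n + a - b := by omega
      simp only [this]
      exact Nat.mod_eq_of_lt (by omega)
  rw [cycleGraph_adj', key, key, Fin.ext_iff, Fin.ext_iff, val_cycSucc, val_cycPred]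
  split_ifs <;> omega

theorem cycleGraph_even_bipartite {k : ℕ} (hk : 2 ≤ k) :
    ∃ c : Fin (2 * k) → Bool, ∀ i j, (cycleGraph (2 * k)).Adj i j → c i ≠ c j := by
  refine ⟨fun i => decide ((i : ℕ) % 2 = 0), fun i j hij => ?_⟩
  have hi := i.2
  rcases (cycleGraph_adj_iff (by omega) i j).1 hij with rfl | rfl
  · rw [ne_eq, decide_eq_decide, val_cycSucc]
    split_ifs <;> omega
  · rw [ne_eq, decide_eq_decide, val_cycPred]
    split_ifs <;> omega

/-- The sequence on the even cycle obtained by repeating twice each colour of a proper colouring of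
`C_k` with colours `0`, `1`, `a`. -/
def doubledColoring {F : Type*} [Field F] (a : F) (k i : ℕ) : F :=
  if i / 2 + 1 = k then a else if i / 2 % 2 = 0 then 0 else 1

theorem doubledColoring_ne {F : Type*} [Field F] {a : F} (ha : a ≠ 0) (ha1 : a ≠ 1) {k : ℕ}
    (hk : 2 ≤ k) (i : Fin (2 * k)) :
    doubledColoring a k (cycPred i) ≠ doubledColoring a k (cycSucc i) := by
  have hi := i.2
  have h : ∃ j j' : ℕ, (cycPred i : ℕ) / 2 = j ∧ (cycSucc i : ℕ) / 2 = j' ∧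
      ((j + 1 < k ∧ j' = j + 1) ∨ (j + 1 = k ∧ j' = 0)) := by
    refine ⟨_, _, rfl, rfl, ?_⟩
    rw [val_cycPred, val_cycSucc]
    split_ifs <;> omega
  obtain ⟨j, j', hj, hj', h⟩ := h
  rw [doubledColoring, doubledColoring, hj, hj']
  rcases h with ⟨h, rfl⟩ | ⟨h, rfl⟩
  · rw [if_neg (by omega)]
    split_ifs <;> first | omega | simp [ha.symm, ha1.symm]
  · rw [if_pos h, if_neg (by omega), if_pos (by norm_num)]
    exact ha

/-- A weighted adjacency matrix of `H □ C_{2k}` built from one of `H`. -/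
def cycleWeight {U F : Type*} [DecidableEq U] [Field F] (B : Matrix U U F) (a : F) (k : ℕ) :
    Matrix (U × Fin (2 * k)) (U × Fin (2 * k)) F := fun p q =>
  (if q.2 = p.2 then
    (doubledColoring a k (cycPred p.2) - doubledColoring a k (cycSucc p.2)) * B p.1 q.1 else 0) +
  ((if q.2 = cycSucc p.2 then (if q.1 = p.1 then 1 else 0) else 0) -
    (if q.2 = cycPred p.2 then (if q.1 = p.1 then 1 else 0) else 0))

theorem cycleWeight_ne_zero_iff {U F : Type*} [DecidableEq U] [Field F] {H : SimpleGraph U}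
    {B : Matrix U U F} (hB : ∀ u v, B u v ≠ 0 ↔ H.Adj u v) {a : F} (ha : a ≠ 0) (ha1 : a ≠ 1)
    {k : ℕ} (hk : 2 ≤ k) (p q : U × Fin (2 * k)) :
    cycleWeight B a k p q ≠ 0 ↔ (H □ cycleGraph (2 * k)).Adj p q := by
  obtain ⟨u, i⟩ := p
  obtain ⟨v, j⟩ := q
  have hi := i.2
  have h1 : cycSucc i ≠ i := by
    rw [ne_eq, Fin.ext_iff, val_cycSucc]; split_ifs <;> omega
  have h2 : cycPred i ≠ i := by
    rw [ne_eq, Fin.ext_iff, val_cycPred]; split_ifs <;> omega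
  have h3 : cycSucc i ≠ cycPred i := by
    rw [ne_eq, Fin.ext_iff, val_cycSucc, val_cycPred]; split_ifs <;> omega
  have hd := sub_ne_zero.2 (doubledColoring_ne ha ha1 hk i)
  rw [boxProd_adj, cycleGraph_adj_iff (by omega)]
  dsimp only [cycleWeight]
  by_cases e1 : j = i
  · subst e1
    simp [h1.symm, h2.symm, hd, ← hB]
  by_cases e2 : j = cycSucc i
  · subst e2
    simp [h1, h1.symm, h3, eq_comm]
  by_cases e3 : j = cycPred i
  · subst e3
    simp [h2, h2.symm, h3.symm, eq_comm]
  simp [e1, e2, e3, Ne.symm e1]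

/-- The parametrisation of the kernel of `cycleWeight B a k` for `B` with square zero. -/
def cycleKernel {U F : Type*} [Fintype U] [Field F] (B : Matrix U U F) (a : F) (k : ℕ) :
    ((U → F) × (U → F)) →ₗ[F] (U × Fin (2 * k) → F) where
  toFun f p := if (p.2 : ℕ) % 2 = 0 then f.1 p.1 + doubledColoring a k p.2 * B.mulVec f.2 p.1
    else f.2 p.1 + doubledColoring a k p.2 * B.mulVec f.1 p.1
  map_add' f g := by
    ext p
    simp only [Prod.fst_add, Prod.snd_add, Matrix.mulVec_add, Pi.add_apply]
    split_ifs <;> ring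
  map_smul' r f := by
    ext p
    simp only [Prod.smul_fst, Prod.smul_snd, Matrix.mulVec_smul, Pi.smul_apply, smul_eq_mul,
      RingHom.id_apply]
    split_ifs <;> ring

theorem cycleKernel_injective {U F : Type*} [Fintype U] [Field F] (B : Matrix U U F) (a : F)
    {k : ℕ} (hk : 2 ≤ k) : Function.Injective (cycleKernel B a k) := by
  have h0 : doubledColoring a k 0 = 0 := by
    rw [doubledColoring, if_neg (by omega), if_pos (by norm_num)]
  have h1 : doubledColoring a k 1 = 0 := by
    rw [doubledColoring, if_neg (by omega), if_pos (by norm_num)]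
  intro f g hfg
  refine Prod.ext (funext fun u => ?_) (funext fun u => ?_)
  · simpa [cycleKernel, h0] using congrFun hfg (u, ⟨0, by omega⟩)
  · simpa [cycleKernel, h1] using congrFun hfg (u, ⟨1, by omega⟩)

theorem cycleWeight_mul_cycleKernel {U F : Type*} [Fintype U] [DecidableEq U] [Field F]
    {B : Matrix U U F} (hB : B * B = 0) (a : F) (k : ℕ) (f : (U → F) × (U → F))
    (p : U × Fin (2 * k)) : ∑ q, cycleWeight B a k p q * cycleKernel B a k f q = 0 := by
  obtain ⟨u, i⟩ := p
  have hi := i.2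
  have hBB (g : U → F) : ∑ v, B u v * B.mulVec g v = 0 := by
    change B.mulVec (B.mulVec g) u = 0
    rw [Matrix.mulVec_mulVec, hB, Matrix.zero_mulVec, Pi.zero_apply]
  have hsum (g g' : U → F) (s : F) : ∑ v, B u v * (g v + s * B.mulVec g' v) = B.mulVec g u := by
    have : ∀ v, B u v * (g v + s * B.mulVec g' v) = B u v * g v + s * (B u v * B.mulVec g' v) :=
      fun v => by ring
    simp only [this]
    rw [Finset.sum_add_distrib, ← Finset.mul_sum, hBB, mul_zero, add_zero]
    rfl
  have hs : (cycSucc i : ℕ) % 2 = 1 - i % 2 := by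
    rw [val_cycSucc]; split_ifs <;> omega
  have hp : (cycPred i : ℕ) % 2 = 1 - i % 2 := by
    rw [val_cycPred]; split_ifs <;> omega
  have hexp : ∑ q, cycleWeight B a k (u, i) q * cycleKernel B a k f q =
      (doubledColoring a k (cycPred i) - doubledColoring a k (cycSucc i)) *
        ∑ v, B u v * cycleKernel B a k f (v, i) +
      (cycleKernel B a k f (u, cycSucc i) - cycleKernel B a k f (u, cycPred i)) := by
    simp only [cycleWeight, Fintype.sum_prod_type, add_mul, sub_mul, ite_mul, zero_mul, one_mul,
      Finset.sum_add_distrib, Finset.sum_sub_distrib, Finset.sum_ite_eq', Finset.mem_univ, if_true,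
      Finset.mul_sum, mul_assoc]
  rw [hexp]
  rcases Nat.mod_two_eq_zero_or_one i with h | h
  · simp only [cycleKernel, LinearMap.coe_mk, AddHom.coe_mk, hs, hp, h, hsum, if_true]
    norm_num
    ring
  · simp only [cycleKernel, LinearMap.coe_mk, AddHom.coe_mk, hs, hp, h]
    norm_num [hsum]
    ring

theorem le_minForcingNumber_boxProd_cycleGraph {U F : Type*} [Fintype U] [DecidableEq U] [Field F]
    (H : SimpleGraph U) (hbip : ∃ c : U → Bool, ∀ u v, H.Adj u v → c u ≠ c v)
    (B : Matrix U U F) (hB : ∀ u v, B u v ≠ 0 ↔ H.Adj u v) (hB0 : B * B = 0)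
    {a : F} (ha : a ≠ 0) (ha1 : a ≠ 1) {k : ℕ} (hk : 2 ≤ k)
    (hex : ∃ M : (H □ cycleGraph (2 * k)).Subgraph, M.IsPerfectMatching) :
    Fintype.card U ≤ minForcingNumber (H □ cycleGraph (2 * k)) := by
  obtain ⟨c, hc⟩ := boxProd_bipartite hbip (cycleGraph_even_bipartite hk)
  refine le_minForcingNumber c hc _ (cycleWeight_ne_zero_iff hB ha ha1 hk) (cycleKernel B a k)
    (cycleKernel_injective B a hk) (cycleWeight_mul_cycleKernel hB0 a k) ?_ hex
  rw [Module.finrank_prod, Module.finrank_fintype_fun_eq_card, two_mul]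

/-- In `H □ C_{2k}` with `H` coloured by `c`: match `(u, i)` forward if the parity of `i` agrees
with the colour of `u`, and backward otherwise. -/
def windingMatch {U : Type*} (c : U → Bool) {n : ℕ} (p : U × Fin n) : U × Fin n :=
  (p.1, if decide ((p.2 : ℕ) % 2 = 0) = c p.1 then cycSucc p.2 else cycPred p.2)

theorem windingMatch_involutive {U : Type*} (c : U → Bool) {k : ℕ} (p : U × Fin (2 * k)) :
    windingMatch c (windingMatch c p) = p := by
  obtain ⟨u, i⟩ := p
  have hi := i.2
  have hs : (cycSucc i : ℕ) % 2 = 1 - i % 2 := by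
    rw [val_cycSucc]; split_ifs <;> omega
  have hp : (cycPred i : ℕ) % 2 = 1 - i % 2 := by
    rw [val_cycPred]; split_ifs <;> omega
  rcases Nat.mod_two_eq_zero_or_one i with h | h <;> cases hc : c u <;>
    simp [windingMatch, h, hs, hp, hc, cycSucc_cycPred, cycPred_cycSucc]

theorem exists_perfectMatching_forced {U : Type*} [Fintype U]
    (H : SimpleGraph U) (hbip : ∃ c : U → Bool, ∀ u v, H.Adj u v → c u ≠ c v)
    {k : ℕ} (hk : 2 ≤ k) :
    ∃ M : (H □ cycleGraph (2 * k)).Subgraph, M.IsPerfectMatching ∧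
      forcingNumber _ M ≤ Fintype.card U := by
  obtain ⟨c, hc⟩ := hbip
  have hadj (p : U × Fin (2 * k)) : (H □ cycleGraph (2 * k)).Adj p (windingMatch c p) := by
    rw [boxProd_adj, cycleGraph_adj_iff (by omega), windingMatch]
    refine Or.inr ⟨?_, rfl⟩
    dsimp only
    split_ifs
    · exact Or.inl rfl
    · exact Or.inr rfl
  have hM := matchingOfInvolution_isPerfectMatching _ (windingMatch_involutive c) hadj
  refine ⟨_, hM, ?_⟩
  let base (u : U) : U × Fin (2 * k) := (u, if c u then ⟨0, by omega⟩ else ⟨1, by omega⟩)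
  let S : Set (Sym2 (U × Fin (2 * k))) := Set.range fun u => s(base u, windingMatch c (base u))
  have hScard : S.ncard ≤ Fintype.card U := by
    change (Set.range _).ncard ≤ _
    rw [← Set.image_univ, ← Nat.card_eq_fintype_card, ← Set.ncard_univ]
    exact Set.ncard_image_le
  refine le_trans (Nat.sInf_le ⟨S, ?_, rfl, ?_⟩) hScard
  · rintro _ ⟨u, rfl⟩
    rfl
  intro M' hM' hSM'
  have huniq {p q r : U × Fin (2 * k)} (h : M'.Adj p q) (h' : M'.Adj p r) : q = r :=
    (Subgraph.isPerfectMatching_iff.1 hM' p).unique h h'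
  have hfwd (t : ℕ) : ∀ (ht : t < 2 * k) (u : U), decide (t % 2 = 0) = c u →
      M'.Adj (u, ⟨t, ht⟩) (u, cycSucc ⟨t, ht⟩) := by
    induction t using Nat.strong_induction_on with
    | _ t ih =>
      intro ht u hu
      by_cases ht2 : t < 2
      · have hbase : base u = (u, ⟨t, ht⟩) := by
          interval_cases t <;> simp [base, ← hu]
        have : s(base u, windingMatch c (base u)) ∈ M'.edgeSet := hSM' ⟨u, rfl⟩
        rw [hbase] at this
        simpa [windingMatch, hu] using this
      obtain ⟨⟨w, j⟩, hwj, -⟩ := Subgraph.isPerfectMatching_iff.1 hM' (u, ⟨t, ht⟩)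
      have hwj' := M'.adj_sub hwj
      rw [boxProd_adj, cycleGraph_adj_iff (by omega)] at hwj'
      rcases hwj' with ⟨h, rfl⟩ | ⟨rfl | rfl, rfl⟩
      · exfalso
        have hcw : decide ((t - 1) % 2 = 0) = c w := by
          have h1 := hc _ _ h
          have h2 : decide ((t - 1) % 2 = 0) = !decide (t % 2 = 0) := by
            rw [← decide_not, decide_eq_decide]; omega
          rw [h2, hu]
          revert h1
          dsimp only
          cases c u <;> cases c w <;> simp
        have h3 := ih (t - 1) (by omega) (by omega) w hcw
        have h4 : cycSucc (⟨t - 1, by omega⟩ : Fin (2 * k)) = ⟨t, ht⟩ := by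
          apply Fin.ext
          rw [val_cycSucc]
          dsimp only
          split_ifs <;> omega
        rw [h4] at h3
        have h5 := congrArg (fun p => (p.2 : ℕ)) (huniq hwj.symm h3.symm)
        dsimp only at h5
        omega
      · exact hwj
      · exfalso
        dsimp only at hwj
        have h3 := ih (t - 2) (by omega) (by omega) u
          (by rw [← hu, decide_eq_decide]; omega)
        have h4 : cycSucc (⟨t - 2, by omega⟩ : Fin (2 * k)) = cycPred ⟨t, ht⟩ := by
          apply Fin.ext
          rw [val_cycSucc, val_cycPred]
          dsimp only
          split_ifs <;> omega
        rw [h4] at h3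
        have h5 := congrArg (fun p => (p.2 : ℕ)) (huniq hwj.symm h3.symm)
        dsimp only at h5
        omega
  refine IsPerfectMatching.eq_of_adj_imp hM hM' ?_
  rintro ⟨u, i⟩ q rfl
  by_cases h : decide ((i : ℕ) % 2 = 0) = c u
  · rw [windingMatch, if_pos h]
    exact hfwd i i.2 u h
  · rw [windingMatch, if_neg h]
    have hi := i.2
    have hp : decide ((cycPred i : ℕ) % 2 = 0) = !decide ((i : ℕ) % 2 = 0) := by
      rw [← decide_not, decide_eq_decide, val_cycPred]
      split_ifs <;> omega
    have := hfwd (cycPred i) (cycPred i).2 u (by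
      rw [hp]
      revert h
      cases c u <;> cases decide ((i : ℕ) % 2 = 0) <;> simp)
    rw [Fin.eta, cycSucc_cycPred] at this
    exact this.symm

theorem stmt10 {V F : Type*} [Fintype V] [DecidableEq V] [Field F]
    (hF : 4 ≤ Cardinal.mk F)
    (G : SimpleGraph V)
    (hbip : ∃ c : V → Bool, ∀ u v, G.Adj u v → c u ≠ c v)
    (A : Matrix V V F) (hA : ∀ u v, A u v ≠ 0 ↔ G.Adj u v)
    (hinv : A * A = 1)
    (d : ℕ) (hd : 1 ≤ d) (k : ℕ) (hk : 2 ≤ k) :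
    minForcingNumber ((G □ hypercube d) □ cycleGraph (2 * k))
      = 2 ^ d * Fintype.card V := by
  classical
  obtain ⟨a, ha, ha1⟩ := exists_ne_zero_sq_ne_one hF
  have ha1' : a ≠ 1 := by
    rintro rfl
    simp at ha1
  obtain ⟨e, rfl⟩ := Nat.exists_eq_add_of_le' hd
  obtain ⟨B, hB, hB1⟩ := exists_weighted_adj_prod_hypercube G A hA hinv a ha ha1 e
  obtain ⟨N, hN, hN0⟩ := exists_weighted_adj_succ G e B hB hB1 a 0 ha (pow_ne_zero 2 ha)
  rw [zero_smul] at hN0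
  have hbip' := boxProd_bipartite hbip (hypercube_bipartite (e + 1))
  obtain ⟨M, hM, hMf⟩ := exists_perfectMatching_forced _ hbip' hk
  have hcard : Fintype.card (V × (Fin (e + 1) → Bool)) = 2 ^ (e + 1) * Fintype.card V := by
    simp [mul_comm]
  rw [← hcard]
  apply le_antisymm
  · exact le_trans (Nat.sInf_le ⟨M, hM, rfl⟩) hMf
  · exact le_minForcingNumber_boxProd_cycleGraph _ hbip' N hN hN0 ha ha1' hk ⟨M, hM⟩
end
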